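/- If two dwROCAs A₁ and A₂ are not equivalent (f_{A₁} ≠ f_{A₂}), then there exists a word w of length O(K²⁶), i.e. |w| ≤ P₀(K) for a fixed polynomial P₀ of degree 26 in K, such that f_{A₁}(w) ≠ f_{A₂}(w), where K is the sum of the numbers of states of A₁ and A₂. -/

import Mathlib

/-- A deterministic weighted real-time one-counter automaton (dwROCA) over
alphabet `A` and field `S`.  `next q b a`, `upd q b a`, `wt q b a` give the
target state, counter update and (nonzero) weight of the unique transition
from state `q` reading letter `a` with counter-status `b` (`true` = counter is
zero). -/
structure DWROCA (A : Type) (S : Type) [Field S] where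
  Q : Type
  fin : Fintype Q
  q0 : Q
  s0 : S
  s0_ne : s0 ≠ 0
  next : Q → Bool → A → Q
  upd : Q → Bool → A → ℤ
  wt : Q → Bool → A → S
  upd_mem : ∀ q b a, upd q b a ∈ ({-1, 0, 1} : Set ℤ)
  no_dec_on_zero : ∀ q a, upd q true a ≠ -1
  wt_ne : ∀ q b a, wt q b a ≠ 0

attribute [instance] DWROCA.fin

/-- Configurations: a state, a counter value and a weight. -/
abbrev DWROCA.Cfg {A S : Type} [Field S] (M : DWROCA A S) : Type := M.Q × ℕ × S

variable {A S : Type} [Field S]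

/-- One step of a dwROCA on a configuration. -/
def DWROCA.step (M : DWROCA A S) (c : M.Cfg) (x : A) : M.Cfg :=
  (M.next c.1 (decide (c.2.1 = 0)) x,
   ((c.2.1 : ℤ) + M.upd c.1 (decide (c.2.1 = 0)) x).toNat,
   c.2.2 * M.wt c.1 (decide (c.2.1 = 0)) x)

/-- The run of a dwROCA on a word from a configuration. -/
def DWROCA.run (M : DWROCA A S) (c : M.Cfg) (w : List A) : M.Cfg :=
  w.foldl M.step c

/-- `f(w, c)`: the value assigned to the word `w` by the configuration `c`. -/
def DWROCA.val (M : DWROCA A S) (c : M.Cfg) (w : List A) : S :=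
  (M.run c w).2.2

/-- The initial configuration. -/
def DWROCA.init (M : DWROCA A S) : M.Cfg := (M.q0, 0, M.s0)

/-- The function `f_A : Σ* → S` computed by a dwROCA. -/
def DWROCA.f (M : DWROCA A S) (w : List A) : S := M.val M.init w

/-- One step of the underlying uninitialised weighted automaton `uwa(M)`:
the counter is ignored (nonzero tests are always taken).  Its configurations
are pairs (state, weight). -/
def DWROCA.ustep (M : DWROCA A S) (c : M.Q × S) (x : A) : M.Q × S :=
  (M.next c.1 false x, c.2 * M.wt c.1 false x)

/-- The value assigned to a word by a configuration of `uwa(M)`. -/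
def DWROCA.uval (M : DWROCA A S) (c : M.Q × S) (w : List A) : S :=
  (w.foldl M.ustep c).2

/-- `k`-equivalence of configurations of two dwROCAs. -/
def kEquiv (M N : DWROCA A S) (c : M.Cfg) (d : N.Cfg) (k : ℕ) : Prop :=
  ∀ w : List A, w.length ≤ k → M.val c w = N.val d w

/-- `k`-equivalence of a configuration of `M` with a configuration of the
underlying weighted automaton `uwa(N)`. -/
def kEquivU (M N : DWROCA A S) (c : M.Cfg) (d : N.Q × S) (k : ℕ) : Prop :=
  ∀ w : List A, w.length ≤ k → M.val c w = N.uval d w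

/-- Membership in `NWA` (relative to the pair `A₁`, `A₂`): a configuration of
`M` (where `M` is `A₁` or `A₂`) not `K`-equivalent to any configuration of
`uwa(A₁) ∪ uwa(A₂)`. -/
def inNWA (A₁ A₂ M : DWROCA A S) (c : M.Cfg) (K : ℕ) : Prop :=
  (∀ d : A₁.Q × S, ¬ kEquivU M A₁ c d K) ∧ (∀ d : A₂.Q × S, ¬ kEquivU M A₂ c d K)

/-- `dist(c)`: least length of a word taking `c` into `NWA` (`⊤` if none). -/
noncomputable def distNWA (A₁ A₂ M : DWROCA A S) (c : M.Cfg) (K : ℕ) : ℕ∞ :=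
  sInf {n : ℕ∞ | ∃ w : List A, (w.length : ℕ∞) = n ∧ inNWA A₁ A₂ M (M.run c w) K}

/-- A configuration pair is surely-equivalent if the two configurations are
`K`-equivalent and both have infinite distance to `NWA`. -/
def surelyEq (A₁ A₂ : DWROCA A S) (c : A₁.Cfg) (d : A₂.Cfg) (K : ℕ) : Prop :=
  kEquiv A₁ A₂ c d K ∧ distNWA A₁ A₂ A₁ c K = ⊤ ∧ distNWA A₁ A₂ A₂ d K = ⊤

/-- A configuration pair is surely-nonequivalent if the two configurations are
not `K`-equivalent or have different distances to `NWA`. -/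
def surelyNonEq (A₁ A₂ : DWROCA A S) (c : A₁.Cfg) (d : A₂.Cfg) (K : ℕ) : Prop :=
  ¬ kEquiv A₁ A₂ c d K ∨ distNWA A₁ A₂ A₁ c K ≠ distNWA A₁ A₂ A₂ d K

/-- A configuration pair is unresolved if the configurations are `K`-equivalent
and have equal finite distances to `NWA`. -/
def unresolved (A₁ A₂ : DWROCA A S) (c : A₁.Cfg) (d : A₂.Cfg) (K : ℕ) : Prop :=
  kEquiv A₁ A₂ c d K ∧ distNWA A₁ A₂ A₁ c K = distNWA A₁ A₂ A₂ d K ∧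
    distNWA A₁ A₂ A₁ c K ≠ ⊤

/-- `w` is a minimal-length witness distinguishing `A₁` and `A₂`. -/
def IsMinWitness (A₁ A₂ : DWROCA A S) (w : List A) : Prop :=
  A₁.f w ≠ A₂.f w ∧ ∀ v : List A, A₁.f v ≠ A₂.f v → w.length ≤ v.length

/-- The `i`-th configuration pair `c_i` of the run of `w` from the initial
configuration pair. -/
def pairAt (A₁ A₂ : DWROCA A S) (w : List A) (i : ℕ) : A₁.Cfg × A₂.Cfg :=
  (A₁.run A₁.init (w.take i), A₂.run A₂.init (w.take i))

/-- Applying a sequence of transition pairs (determined, by determinism, by a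
word) to a configuration pair. -/
def runPair (A₁ A₂ : DWROCA A S) (c : A₁.Cfg × A₂.Cfg) (w : List A) :
    A₁.Cfg × A₂.Cfg :=
  (A₁.run c.1 w, A₂.run c.2 w)

/-- A configuration pair lies in the belt of slope `α/β` and thickness `d`. -/
def inBelt (α β d : ℕ) {A₁ A₂ : DWROCA A S} (c : A₁.Cfg × A₂.Cfg) : Prop :=
  |(α : ℤ) * (c.1.2.1 : ℤ) - (β : ℤ) * (c.2.2.1 : ℤ)| ≤ (d : ℤ)

/-- Two configuration pairs are `(α/β)`-related: same state pairs and same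
value of `α·m - β·n`. -/
def abRelated (α β : ℕ) {A₁ A₂ : DWROCA A S} (c c' : A₁.Cfg × A₂.Cfg) : Prop :=
  c.1.1 = c'.1.1 ∧ c.2.1 = c'.2.1 ∧
    (α : ℤ) * (c.1.2.1 : ℤ) - (β : ℤ) * (c.2.2.1 : ℤ) =
      (α : ℤ) * (c'.1.2.1 : ℤ) - (β : ℤ) * (c'.2.2.1 : ℤ)

namespace OneCounter

/-- A deterministic one-counter machine emitting one output symbol per letter; the Boolean
argument tells whether the counter is zero. -/
structure Mach (Q Γ Ω : Type) where
  nx : Q → Bool → Γ → Q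
  up : Q → Bool → Γ → ℤ
  ou : Q → Bool → Γ → Ω
  abs_up_le : ∀ q b a, |up q b a| ≤ 1

/-- Configurations: a state with a counter value, or a state of the underlying finite machine in
which the counter is regarded as infinite. -/
inductive Conf (Q : Type)
  | fin (q : Q) (n : ℕ)
  | inf (q : Q)

namespace Mach

open Conf

variable {Q Γ Ω : Type} (M : Mach Q Γ Ω)

/-- One step of the machine. -/
def step : Conf Q → Γ → Conf Q
  | fin q n, a =>
    fin (M.nx q (decide (n = 0)) a) ((n : ℤ) + M.up q (decide (n = 0)) a).toNat
  | inf q, a => inf (M.nx q false a)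

/-- The output symbol emitted in one step. -/
def out : Conf Q → Γ → Ω
  | fin q n, a => M.ou q (decide (n = 0)) a
  | inf q, a => M.ou q false a

/-- The configuration reached on a word. -/
def run (x : Conf Q) (w : List Γ) : Conf Q := w.foldl M.step x

/-- The output produced on a word. -/
def outs : Conf Q → List Γ → List Ω
  | _, [] => []
  | x, a :: w => M.out x a :: outs (M.step x a) w

/-- The length of a shortest word on which two configurations produce different outputs. -/
noncomputable def el (x y : Conf Q) : ℕ∞ :=
  ⨅ w ∈ {w : List Γ | M.outs x w ≠ M.outs y w}, (w.length : ℕ∞)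

@[simp] lemma run_nil (x : Conf Q) : M.run x [] = x := rfl

@[simp] lemma run_cons (x : Conf Q) (a : Γ) (w : List Γ) :
    M.run x (a :: w) = M.run (M.step x a) w := rfl

lemma run_append (x : Conf Q) (u v : List Γ) : M.run x (u ++ v) = M.run (M.run x u) v := by
  simp [run]

@[simp] lemma outs_nil (x : Conf Q) : M.outs x [] = [] := rfl

@[simp] lemma outs_cons (x : Conf Q) (a : Γ) (w : List Γ) :
    M.outs x (a :: w) = M.out x a :: M.outs (M.step x a) w := rfl

@[simp] lemma length_outs (x : Conf Q) (w : List Γ) : (M.outs x w).length = w.length := by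
  induction w generalizing x with
  | nil => rfl
  | cons a w ih => simp [ih]

lemma outs_append (x : Conf Q) (u v : List Γ) :
    M.outs x (u ++ v) = M.outs x u ++ M.outs (M.run x u) v := by
  induction u generalizing x with
  | nil => rfl
  | cons a u ih => simp [ih]

lemma outs_append_ne {x y : Conf Q} {u v : List Γ}
    (h : M.outs (M.run x u) v ≠ M.outs (M.run y u) v) :
    M.outs x (u ++ v) ≠ M.outs y (u ++ v) := by
  rw [outs_append, outs_append]
  intro h'
  exact h (List.append_inj_right h' (by simp))

lemma el_le {x y : Conf Q} {w : List Γ} (h : M.outs x w ≠ M.outs y w) :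
    M.el x y ≤ w.length :=
  iInf₂_le w h

lemma exists_word {x y : Conf Q} (h : M.el x y ≠ ⊤) :
    ∃ w : List Γ, M.outs x w ≠ M.outs y w ∧ M.el x y = w.length := by
  by_contra! hc
  have hne : {w : List Γ | M.outs x w ≠ M.outs y w}.Nonempty := by
    by_contra he
    rw [Set.not_nonempty_iff_eq_empty] at he
    exact h (by simp [el, he])
  obtain ⟨n, hn⟩ := ENat.ne_top_iff_exists.mp h
  have hlt : ∀ w ∈ {w : List Γ | M.outs x w ≠ M.outs y w}, ((n + 1 : ℕ) : ℕ∞) ≤ w.length := by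
    intro w hw
    have h1 := M.el_le hw
    have h2 := hc w hw
    rw [← hn] at h1 h2
    have h1' : n ≤ w.length := by exact_mod_cast h1
    have h2' : n ≠ w.length := by exact_mod_cast h2
    exact_mod_cast (by omega : n + 1 ≤ w.length)
  have : ((n + 1 : ℕ) : ℕ∞) ≤ M.el x y := le_iInf₂ hlt
  rw [← hn] at this
  have : n + 1 ≤ n := by exact_mod_cast this
  omega

lemma outs_eq_of_lt {x y : Conf Q} {w : List Γ} (h : (w.length : ℕ∞) < M.el x y) :
    M.outs x w = M.outs y w := by
  by_contra hc
  exact absurd (M.el_le hc) (not_le.mpr h)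

lemma lt_el {x y : Conf Q} {k : ℕ} (h : ∀ w : List Γ, w.length ≤ k → M.outs x w = M.outs y w) :
    (k : ℕ∞) < M.el x y := by
  by_contra hc
  rw [not_lt] at hc
  obtain ⟨w, hw, hl⟩ := M.exists_word (ne_top_of_le_ne_top (ENat.natCast_ne_top k) hc)
  rw [hl] at hc
  exact hw (h w (by exact_mod_cast hc))

lemma el_comm (x y : Conf Q) : M.el x y = M.el y x := by
  simp only [el, ne_comm]

lemma min_el_le (x y z : Conf Q) : min (M.el x y) (M.el y z) ≤ M.el x z := by
  by_contra! hc
  obtain ⟨w, hw, hl⟩ := M.exists_word hc.ne_top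
  rw [hl, lt_min_iff] at hc
  exact hw ((M.outs_eq_of_lt hc.1).trans (M.outs_eq_of_lt hc.2))

lemma el_eq_of_lt {x y z : Conf Q} (h : M.el x y < M.el y z) : M.el x z = M.el x y := by
  apply le_antisymm
  · have := M.min_el_le x z y
    rw [M.el_comm z y, min_le_iff] at this
    exact this.resolve_right (not_le.mpr h)
  · have := M.min_el_le x y z
    rwa [min_eq_left h.le] at this

lemma el_congr_right {x y z : Conf Q} (h : M.el y z = ⊤) : M.el x y = M.el x z := by
  apply le_antisymm
  · simpa [h] using M.min_el_le x y z
  · simpa [M.el_comm z y, h] using M.min_el_le x z y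

lemma el_le_run (x y : Conf Q) (u : List Γ) :
    M.el x y ≤ u.length + M.el (M.run x u) (M.run y u) := by
  by_cases h : M.el (M.run x u) (M.run y u) = ⊤
  · simp [h]
  · obtain ⟨v, hv, hl⟩ := M.exists_word h
    rw [hl]
    refine (M.el_le (M.outs_append_ne hv)).trans ?_
    simp

lemma el_run_eq_top {x y : Conf Q} (h : M.el x y = ⊤) (u : List Γ) :
    M.el (M.run x u) (M.run y u) = ⊤ := by
  have := M.el_le_run x y u
  rw [h, top_le_iff] at this
  simpa using this

/-- After reading a proper prefix of a shortest witness, the rest is a shortest witness. -/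
lemma el_run_of_append {x y : Conf Q} {u v : List Γ} (h : M.outs x (u ++ v) ≠ M.outs y (u ++ v))
    (hl : M.el x y = (u ++ v).length) (hv : v ≠ []) :
    M.outs (M.run x u) v ≠ M.outs (M.run y u) v ∧ M.el (M.run x u) (M.run y u) = v.length := by
  have hu : M.outs x u = M.outs y u := by
    apply M.outs_eq_of_lt
    rw [hl]
    have := List.length_pos_iff.mpr hv
    exact_mod_cast (by simp; omega : u.length < (u ++ v).length)
  have hW : M.outs (M.run x u) v ≠ M.outs (M.run y u) v := by
    intro hc
    apply h
    rw [outs_append, outs_append, hu, hc]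
  refine ⟨hW, le_antisymm (M.el_le hW) ?_⟩
  have h1 := M.el_le_run x y u
  rw [hl, List.length_append, Nat.cast_add] at h1
  exact (ENat.add_le_add_iff_left (ENat.natCast_ne_top _)).mp h1

lemma exists_step {x y : Conf Q} {n : ℕ} (hn : 1 ≤ n) (h : M.el x y = (n + 1 : ℕ)) :
    ∃ a, M.el (M.step x a) (M.step y a) = n := by
  obtain ⟨w, hw, hl⟩ := M.exists_word (x := x) (y := y) (by rw [h]; exact ENat.natCast_ne_top _)
  have hlen : w.length = n + 1 := by
    rw [h] at hl
    exact_mod_cast hl.symm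
  obtain ⟨a, v, rfl⟩ := List.exists_cons_of_length_eq_add_one hlen
  have hv : v ≠ [] := by
    rintro rfl
    simp at hlen
    omega
  have := (M.el_run_of_append (u := [a]) (v := v) hw hl hv).2
  refine ⟨a, ?_⟩
  simp only [run_cons, run_nil] at this
  rw [this]
  simp at hlen
  exact_mod_cast hlen

/-- A shortest witness, presented as a pair of trajectories along which `el` decreases by one. -/
lemma exists_minimal_run {x y : Conf Q} {L : ℕ} (h : M.el x y = L) :
    ∃ (g : ℕ → Γ) (X Y : ℕ → Conf Q), X 0 = x ∧ Y 0 = y ∧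
      (∀ i, X (i + 1) = M.step (X i) (g i)) ∧ (∀ i, Y (i + 1) = M.step (Y i) (g i)) ∧
      ∀ i, i < L → M.el (X i) (Y i) = (L - i : ℕ) := by
  classical
  obtain ⟨w, hw, -⟩ := M.exists_word (x := x) (y := y) (by rw [h]; exact ENat.natCast_ne_top _)
  obtain ⟨a₀, -⟩ : ∃ a : Γ, a ∈ w := by
    apply List.exists_mem_of_ne_nil
    rintro rfl
    exact hw rfl
  let ch : Conf Q × Conf Q → Γ := fun z =>
    if hz : ∃ a, M.el (M.step z.1 a) (M.step z.2 a) + 1 = M.el z.1 z.2 then hz.choose else a₀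
  let Z : ℕ → Conf Q × Conf Q := fun i =>
    Nat.rec (x, y) (fun _ z => (M.step z.1 (ch z), M.step z.2 (ch z))) i
  refine ⟨fun i => ch (Z i), fun i => (Z i).1, fun i => (Z i).2, rfl, rfl, fun _ => rfl,
    fun _ => rfl, ?_⟩
  intro i
  induction i with
  | zero => intro _; simpa [Z] using h
  | succ i ih =>
    intro hi
    have hi' := ih (by omega)
    have hex : ∃ a, M.el (M.step (Z i).1 a) (M.step (Z i).2 a) + 1 = M.el (Z i).1 (Z i).2 := by
      obtain ⟨a, ha⟩ := M.exists_step (x := (Z i).1) (y := (Z i).2) (n := L - (i + 1)) (by omega)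
        (by rw [hi']; congr 1; omega)
      refine ⟨a, ?_⟩
      rw [ha, hi']
      exact_mod_cast (by omega : L - (i + 1) + 1 = L - i)
    have hc : ch (Z i) = hex.choose := dif_pos hex
    have hs := hex.choose_spec.trans hi'
    change M.el (M.step (Z i).1 (ch (Z i))) (M.step (Z i).2 (ch (Z i))) = _
    rw [hc]
    have : ((L - i : ℕ) : ℕ∞) = (L - (i + 1) : ℕ) + 1 := by
      exact_mod_cast (by omega : L - i = L - (i + 1) + 1)
    rw [this] at hs
    exact ENat.add_left_injective_of_ne_top ENat.one_ne_top hs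

/-- The state reached on a word when the counter never vanishes. -/
def un (p : Q) (u : List Γ) : Q := u.foldl (fun q a => M.nx q false a) p

/-- The change of the counter on a word when the counter never vanishes. -/
def eff : Q → List Γ → ℤ
  | _, [] => 0
  | p, a :: u => M.up p false a + eff (M.nx p false a) u

@[simp] lemma un_nil (p : Q) : M.un p [] = p := rfl

@[simp] lemma un_cons (p : Q) (a : Γ) (u : List Γ) :
    M.un p (a :: u) = M.un (M.nx p false a) u := rfl

lemma un_append (p : Q) (u v : List Γ) : M.un p (u ++ v) = M.un (M.un p u) v := by
  simp [un]

@[simp] lemma eff_nil (p : Q) : M.eff p [] = 0 := rfl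

@[simp] lemma eff_cons (p : Q) (a : Γ) (u : List Γ) :
    M.eff p (a :: u) = M.up p false a + M.eff (M.nx p false a) u := rfl

lemma eff_append (p : Q) (u v : List Γ) :
    M.eff p (u ++ v) = M.eff p u + M.eff (M.un p u) v := by
  induction u generalizing p with
  | nil => simp
  | cons a u ih => simp [ih, add_assoc]

lemma up_bounds (q : Q) (b : Bool) (a : Γ) : -1 ≤ M.up q b a ∧ M.up q b a ≤ 1 :=
  abs_le.mp (M.abs_up_le q b a)

lemma eff_bounds (p : Q) (u : List Γ) : -(u.length : ℤ) ≤ M.eff p u ∧ M.eff p u ≤ u.length := by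
  induction u generalizing p with
  | nil => simp
  | cons a u ih =>
    have h1 := M.up_bounds p false a
    have h2 := ih (M.nx p false a)
    simp only [eff_cons, List.length_cons, Nat.cast_add, Nat.cast_one]
    omega

@[simp] lemma run_inf (p : Q) (u : List Γ) : M.run (inf p) u = inf (M.un p u) := by
  induction u generalizing p with
  | nil => rfl
  | cons a u ih => simp [step, ih]

lemma step_fin_of_pos (p : Q) {m : ℕ} (hm : 0 < m) (a : Γ) :
    M.step (fin p m) a = fin (M.nx p false a) ((m : ℤ) + M.up p false a).toNat := by
  simp [step, hm.ne']

lemma out_fin_of_pos (p : Q) {m : ℕ} (hm : 0 < m) (a : Γ) :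
    M.out (fin p m) a = M.out (inf p) a := by
  simp [out, hm.ne']

lemma run_outs_of_pos (p : Q) (m : ℕ) (u : List Γ)
    (h : ∀ v w, u = v ++ w → w ≠ [] → 0 < (m : ℤ) + M.eff p v) :
    M.run (fin p m) u = fin (M.un p u) ((m : ℤ) + M.eff p u).toNat ∧
      M.outs (fin p m) u = M.outs (inf p) u := by
  induction u generalizing p m with
  | nil => simp
  | cons a u ih =>
    have hm : 0 < m := by
      have := h [] (a :: u) rfl (by simp)
      simpa using this
    have hb := M.up_bounds p false a
    have hc : ((((m : ℤ) + M.up p false a).toNat : ℕ) : ℤ) = m + M.up p false a := by omega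
    have := ih (M.nx p false a) ((m : ℤ) + M.up p false a).toNat (by
      intro v w hu hw
      have := h (a :: v) w (by simp [hu]) hw
      rw [eff_cons] at this
      rw [hc]
      linarith)
    rw [hc] at this
    refine ⟨?_, ?_⟩
    · rw [run_cons, M.step_fin_of_pos p hm, this.1, un_cons, eff_cons, add_assoc]
    · rw [outs_cons, outs_cons, M.step_fin_of_pos p hm, this.2, M.out_fin_of_pos p hm]
      rfl

lemma pos_of_length_le {p : Q} {m : ℕ} {u : List Γ} (h : u.length ≤ m) :
    ∀ v w, u = v ++ w → w ≠ [] → 0 < (m : ℤ) + M.eff p v := by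
  rintro v w rfl hw
  have h1 := (M.eff_bounds p v).1
  have h2 := List.length_pos_iff.mpr hw
  simp only [List.length_append] at h
  omega

lemma run_fin {p : Q} {m m' : ℕ} {u : List Γ} (h : u.length ≤ m)
    (hm : (m' : ℤ) = m + M.eff p u) : M.run (fin p m) u = fin (M.un p u) m' := by
  rw [(M.run_outs_of_pos p m u (M.pos_of_length_le h)).1, ← hm, Int.toNat_natCast]

lemma outs_fin {p : Q} {m : ℕ} {u : List Γ} (h : u.length ≤ m) :
    M.outs (fin p m) u = M.outs (inf p) u :=
  (M.run_outs_of_pos p m u (M.pos_of_length_le h)).2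

lemma lt_el_inf (p : Q) (m : ℕ) : (m : ℕ∞) < M.el (fin p m) (inf p) :=
  M.lt_el fun _ hw => M.outs_fin hw

/-- A word distinguishing a configuration from its state drives the counter to zero. -/
lemma exists_prefix_of_outs_ne {p : Q} {m : ℕ} {u : List Γ}
    (h : M.outs (fin p m) u ≠ M.outs (inf p) u) :
    ∃ v w, u = v ++ w ∧ w ≠ [] ∧ (m : ℤ) + M.eff p v ≤ 0 := by
  by_contra! hc
  exact h (M.run_outs_of_pos p m u hc).2

/-- The infix of length `l` starting at `b` of an infinite word. -/
def seg (g : ℕ → Γ) (b : ℕ) : ℕ → List Γ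
  | 0 => []
  | l + 1 => seg g b l ++ [g (b + l)]

@[simp] lemma length_seg (g : ℕ → Γ) (b l : ℕ) : (seg g b l).length = l := by
  induction l with
  | zero => rfl
  | succ l ih => simp [seg, ih]

/-- `p`, `m` are the states and counter values of a run on the infinite word `g`. -/
def Traj (g : ℕ → Γ) (p : ℕ → Q) (m : ℕ → ℕ) : Prop :=
  ∀ i, M.step (fin (p i) (m i)) (g i) = fin (p (i + 1)) (m (i + 1))

/-- Consecutive values differ by at most one. -/
def Slow (h : ℕ → ℕ) : Prop := ∀ i, h (i + 1) ≤ h i + 1 ∧ h i ≤ h (i + 1) + 1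

variable {M}

lemma Traj.slow {g : ℕ → Γ} {p : ℕ → Q} {m : ℕ → ℕ} (h : M.Traj g p m) : Slow m := by
  intro i
  have h1 := h i
  simp only [step, fin.injEq] at h1
  have h2 := M.up_bounds (p i) (decide (m i = 0)) (g i)
  omega

lemma Traj.run_seg_sub {g : ℕ → Γ} {p : ℕ → Q} {m : ℕ → ℕ} (h : M.Traj g p m) (b l Δ : ℕ)
    (hp : ∀ j, b ≤ j → j < b + l → Δ < m j) :
    M.run (fin (p b) (m b - Δ)) (seg g b l) = fin (p (b + l)) (m (b + l) - Δ) := by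
  induction l with
  | zero => rfl
  | succ l ih =>
    have hj := hp (b + l) (by omega) (by omega)
    rw [seg, run_append, ih fun j h1 h2 => hp j h1 (by omega), run_cons, run_nil,
      M.step_fin_of_pos _ (by omega)]
    have h1 := h (b + l)
    rw [M.step_fin_of_pos _ (by omega), fin.injEq] at h1
    have h2 := M.up_bounds (p (b + l)) false (g (b + l))
    rw [fin.injEq, ← add_assoc]
    refine ⟨h1.1, ?_⟩
    omega

lemma Traj.un_seg {g : ℕ → Γ} {p : ℕ → Q} {m : ℕ → ℕ} (h : M.Traj g p m) (b l : ℕ)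
    (hp : ∀ j, b ≤ j → j < b + l → 0 < m j) : M.un (p b) (seg g b l) = p (b + l) := by
  induction l with
  | zero => rfl
  | succ l ih =>
    have hj := hp (b + l) (by omega) (by omega)
    rw [seg, un_append, ih fun j h1 h2 => hp j h1 (by omega)]
    have h1 := h (b + l)
    rw [M.step_fin_of_pos _ (by omega), fin.injEq] at h1
    exact h1.1

lemma exists_traj {g : ℕ → Γ} {X : ℕ → Conf Q} (h : ∀ i, X (i + 1) = M.step (X i) (g i))
    {p₀ : Q} {m₀ : ℕ} (h0 : X 0 = fin p₀ m₀) :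
    ∃ p m, M.Traj g p m ∧ ∀ i, X i = fin (p i) (m i) := by
  have hX : ∀ i, ∃ z : Q × ℕ, X i = fin z.1 z.2 := by
    intro i
    induction i with
    | zero => exact ⟨(p₀, m₀), h0⟩
    | succ i ih =>
      obtain ⟨z, hz⟩ := ih
      rw [h, hz]
      exact ⟨(_, _), rfl⟩
  choose z hz using hX
  refine ⟨fun i => (z i).1, fun i => (z i).2, fun i => ?_, hz⟩
  rw [← hz, ← hz, h]

lemma exists_un_traj {g : ℕ → Γ} {X : ℕ → Conf Q} (h : ∀ i, X (i + 1) = M.step (X i) (g i))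
    {p₀ : Q} (h0 : X 0 = inf p₀) :
    ∃ p : ℕ → Q, ∀ i, X i = inf (p i) := by
  have hX : ∀ i, ∃ z : Q, X i = inf z := by
    intro i
    induction i with
    | zero => exact ⟨p₀, h0⟩
    | succ i ih =>
      obtain ⟨z, hz⟩ := ih
      rw [h, hz]
      exact ⟨_, rfl⟩
  choose z hz using hX
  exact ⟨z, hz⟩

lemma Slow.exists_last {h : ℕ → ℕ} (hs : Slow h) {i j l : ℕ} (hij : i ≤ j) (hi : h i ≤ l)
    (hj : l ≤ h j) : ∃ a, i ≤ a ∧ a ≤ j ∧ h a = l ∧ ∀ k, a < k → k ≤ j → l < h k := by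
  induction j, hij using Nat.le_induction with
  | base => exact ⟨i, le_rfl, le_rfl, by omega, fun k h1 h2 => by omega⟩
  | succ j hij ih =>
    by_cases hc : l = h (j + 1)
    · exact ⟨j + 1, by omega, le_rfl, hc.symm, fun k h1 h2 => by omega⟩
    · obtain ⟨a, h1, h2, h3, h4⟩ := ih (by have := hs j; omega)
      refine ⟨a, h1, by omega, h3, fun k hk hk' => ?_⟩
      rcases Nat.lt_or_ge j k with h | h
      · obtain rfl : k = j + 1 := by omega
        omega
      · exact h4 k hk h

lemma Slow.exists_first {h : ℕ → ℕ} (hs : Slow h) {i j l : ℕ} (hij : i ≤ j) (hi : l ≤ h i)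
    (hj : h j ≤ l) : ∃ d, i ≤ d ∧ d ≤ j ∧ h d = l ∧ ∀ k, i ≤ k → k < d → l < h k := by
  classical
  have hex : ∃ d, i ≤ d ∧ h d ≤ l := ⟨j, hij, hj⟩
  have hsp := Nat.find_spec hex
  have hmin : ∀ k, i ≤ k → k < Nat.find hex → l < h k := by
    intro k h1 h2
    have := Nat.find_min hex h2
    omega
  refine ⟨Nat.find hex, hsp.1, Nat.find_min' hex ⟨hij, hj⟩, ?_, hmin⟩
  rcases hsp.1.eq_or_lt with h | h
  · rw [← h] at hsp ⊢
    omega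
  · have h1 := hmin (Nat.find hex - 1) (by omega) (by omega)
    have h2 := hs (Nat.find hex - 1)
    rw [Nat.sub_add_cancel (by omega)] at h2
    omega

/-- Two levels whose last crossings before `j` have equal types. -/
lemma Slow.exists_up {τ : Type} {h : ℕ → ℕ} (hs : Slow h) {i j l N : ℕ} (hij : i ≤ j)
    (hi : h i ≤ l) (hj : l + N ≤ h j) (f : ℕ → τ) (T : Finset τ)
    (hf : ∀ k, i ≤ k → k ≤ j → f k ∈ T) (hT : T.card ≤ N) :
    ∃ a b, i ≤ a ∧ a < b ∧ b ≤ j ∧ l ≤ h a ∧ h a < h b ∧ f a = f b ∧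
      (∀ k, b ≤ k → k ≤ j → h b ≤ h k) ∧ (∀ k, a ≤ k → k ≤ j → h a ≤ h k) := by
  have key : ∀ x : ℕ, ∃ a, x ≤ N → i ≤ a ∧ a ≤ j ∧ h a = l + x ∧ ∀ k, a < k → k ≤ j → l + x < h k := by
    intro x
    by_cases hx : x ≤ N
    · obtain ⟨a, ha⟩ := hs.exists_last (l := l + x) hij (by omega) (by omega)
      exact ⟨a, fun _ => ha⟩
    · exact ⟨0, fun h => absurd h hx⟩
  choose A hA using key
  obtain ⟨x, hx, y, hy, hxy, he⟩ := Finset.exists_ne_map_eq_of_card_lt_of_maps_to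
    (s := Finset.range (N + 1)) (t := T) (f := fun x => f (A x)) (by simp; omega)
    (by
      intro x hx
      have hx' := hA x (by simp at hx; omega)
      exact hf _ hx'.1 hx'.2.1)
  wlog hlt : x < y generalizing x y
  · exact this y hy x hx hxy.symm he.symm (by omega)
  have hx' := hA x (by simp at hx; omega)
  have hy' := hA y (by simp at hy; omega)
  refine ⟨A x, A y, hx'.1, ?_, hy'.2.1, by omega, by omega, he, ?_, ?_⟩
  · by_contra hc
    rcases (not_lt.mp hc).eq_or_lt with h1 | h1
    · rw [h1] at hy'
      omega
    · have := hy'.2.2.2 _ h1 hx'.2.1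
      omega
  · intro k h1 h2
    rcases h1.eq_or_lt with h | h
    · rw [h]
    · have := hy'.2.2.2 k h h2
      omega
  · intro k h1 h2
    rcases h1.eq_or_lt with h | h
    · rw [h]
    · have := hx'.2.2.2 k h h2
      omega

/-- Two levels whose last crossings before the peak `j` and first crossings after it have equal
types. -/
lemma Slow.exists_up_down {τ : Type} {h : ℕ → ℕ} (hs : Slow h) {i j e l N : ℕ} (hij : i ≤ j)
    (hje : j ≤ e) (hi : h i ≤ l) (he : h e ≤ l) (hj : l + N ≤ h j) (f : ℕ → τ) (T : Finset τ)
    (hf : ∀ k, i ≤ k → k ≤ e → f k ∈ T) (hT : T.card ^ 2 ≤ N) :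
    ∃ a b c d, i ≤ a ∧ a < b ∧ b ≤ c ∧ c < d ∧ d ≤ e ∧ l ≤ h a ∧ h a < h b ∧ h d = h a ∧
      h c = h b ∧ f a = f b ∧ f c = f d ∧
      (∀ k, b ≤ k → k ≤ c → h b ≤ h k) ∧ (∀ k, a ≤ k → k ≤ d → h a ≤ h k) := by
  have key : ∀ x : ℕ, ∃ a d, x ≤ N → (i ≤ a ∧ a ≤ j ∧ h a = l + x ∧
      ∀ k, a < k → k ≤ j → l + x < h k) ∧ (j ≤ d ∧ d ≤ e ∧ h d = l + x ∧
      ∀ k, j ≤ k → k < d → l + x < h k) := by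
    intro x
    by_cases hx : x ≤ N
    · obtain ⟨a, ha⟩ := hs.exists_last (l := l + x) hij (by omega) (by omega)
      obtain ⟨d, hd⟩ := hs.exists_first (l := l + x) hje (by omega) (by omega)
      exact ⟨a, d, fun _ => ⟨ha, hd⟩⟩
    · exact ⟨0, 0, fun h => absurd h hx⟩
  choose A D hA using key
  obtain ⟨x, hx, y, hy, hxy, hf'⟩ := Finset.exists_ne_map_eq_of_card_lt_of_maps_to
    (s := Finset.range (N + 1)) (t := T ×ˢ T) (f := fun x => (f (A x), f (D x)))
    (by rw [Finset.card_product, Finset.card_range, ← sq]; omega)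
    (by
      intro x hx
      obtain ⟨h1, h2⟩ := hA x (by simp at hx; omega)
      exact Finset.mk_mem_product (hf _ h1.1 (by omega)) (hf _ (by omega) h2.2.1))
  wlog hlt : x < y generalizing x y
  · exact this y hy x hx hxy.symm hf'.symm (by omega)
  obtain ⟨hx1, hx2⟩ := hA x (by simp at hx; omega)
  obtain ⟨hy1, hy2⟩ := hA y (by simp at hy; omega)
  rw [Prod.mk.injEq] at hf'
  have above : ∀ z : ℕ, (i ≤ A z ∧ A z ≤ j ∧ h (A z) = l + z ∧
      ∀ k, A z < k → k ≤ j → l + z < h k) → (j ≤ D z ∧ D z ≤ e ∧ h (D z) = l + z ∧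
      ∀ k, j ≤ k → k < D z → l + z < h k) → ∀ k, A z ≤ k → k ≤ D z → l + z ≤ h k := by
    intro z h1 h2 k hk hk'
    rcases hk.eq_or_lt with h | h
    · rw [← h]
      omega
    rcases hk'.eq_or_lt with h' | h'
    · rw [h']
      omega
    rcases le_total k j with hj | hj
    · exact (h1.2.2.2 k h hj).le
    · exact (h2.2.2.2 k hj h').le
  have hab : A x < A y := by
    by_contra hc
    have := above y hy1 hy2 (A x) (by omega) (by omega)
    omega
  have hcd : D y < D x := by
    by_contra hc
    have := above y hy1 hy2 (D x) (by omega) (by omega)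
    omega
  refine ⟨A x, A y, D y, D x, hx1.1, hab, by omega, hcd, hx2.2.1, by omega, by omega, by omega,
    by omega, hf'.1, hf'.2.symm, ?_, ?_⟩
  · intro k h1 h2
    rw [hy1.2.2.1]
    exact above y hy1 hy2 k h1 h2
  · intro k h1 h2
    rw [hx1.2.2.1]
    exact above x hx1 hx2 k h1 h2

variable (M)

/-- Finitely many positions whose remaining distance is determined by a type. -/
lemma card_le_of_determined {τ : Type} [DecidableEq τ] {X Y : ℕ → Conf Q} {L : ℕ}
    (hel : ∀ i, i < L → M.el (X i) (Y i) = (L - i : ℕ)) (s : Finset ℕ) (hs : ∀ i ∈ s, i < L)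
    (f : ℕ → τ) (T : Finset τ) (hf : ∀ i ∈ s, f i ∈ T)
    (hd : ∀ i ∈ s, ∀ j ∈ s, f i = f j → M.el (X i) (Y i) = M.el (X j) (Y j)) :
    s.card ≤ T.card := by
  refine Finset.card_le_card_of_injOn f hf fun i hi j hj hij => ?_
  have := hd i hi j hj hij
  rw [hel i (hs i hi), hel j (hs j hj)] at this
  have h1 := hs i hi
  have h2 := hs j hj
  have : L - i = L - j := by exact_mod_cast this
  omega

/-- The `k`-fold repetition of a word. -/
def wpow (z : List Γ) (k : ℕ) : List Γ := (List.replicate k z).flatten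

@[simp] lemma wpow_zero (z : List Γ) : wpow z 0 = [] := rfl

lemma wpow_succ (z : List Γ) (k : ℕ) : wpow z (k + 1) = z ++ wpow z k := rfl

@[simp] lemma length_wpow (z : List Γ) (k : ℕ) : (wpow z k).length = k * z.length := by
  simp [wpow]

lemma wpow_add (z : List Γ) (k l : ℕ) : wpow z (k + l) = wpow z k ++ wpow z l := by
  simp only [wpow, List.replicate_add, List.flatten_append]

variable {M}

lemma un_wpow {x : Q} {z : List Γ} (h : M.un x z = x) (k : ℕ) : M.un x (wpow z k) = x := by
  induction k with
  | zero => rfl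
  | succ k ih => rw [wpow_succ, un_append, h, ih]

lemma eff_wpow {x : Q} {z : List Γ} (h : M.un x z = x) (k : ℕ) :
    M.eff x (wpow z k) = k * M.eff x z := by
  induction k with
  | zero => simp
  | succ k ih => rw [wpow_succ, eff_append, h, ih]; push_cast; ring

lemma run_wpow {x : Q} {z : List Γ} (h : M.un x z = x) {k m m' : ℕ} (hm : z.length ≤ m)
    (hm' : z.length ≤ m') (he : (m' : ℤ) = m + k * M.eff x z) :
    M.run (fin x m) (wpow z k) = fin x m' := by
  induction k generalizing m with
  | zero =>
    obtain rfl : m' = m := by simpa using he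
    rfl
  | succ k ih =>
    have hb := M.eff_bounds x z
    push_cast at he
    have key : (z.length : ℤ) ≤ m + M.eff x z := by
      rcases le_total 0 (M.eff x z) with h0 | h0
      · omega
      · have : (k : ℤ) * M.eff x z ≤ 0 := mul_nonpos_of_nonneg_of_nonpos (by positivity) h0
        linarith [(by exact_mod_cast hm' : (z.length : ℤ) ≤ m')]
    have hc : (((m : ℤ) + M.eff x z).toNat : ℤ) = m + M.eff x z := by omega
    rw [wpow_succ, run_append, M.run_fin hm hc, h]
    refine ih (by omega) ?_
    rw [hc, he]
    ring

variable (M)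

/-- All states visited from `p` on a word, with the counter never vanishing, belong to `S`. -/
def Within (S : Set Q) : Q → List Γ → Prop
  | p, [] => p ∈ S
  | p, a :: u => p ∈ S ∧ Within S (M.nx p false a) u

variable {M}

lemma within_append {S : Set Q} {p : Q} {u v : List Γ} :
    M.Within S p (u ++ v) ↔ M.Within S p u ∧ M.Within S (M.un p u) v := by
  induction u generalizing p with
  | nil =>
    cases v with
    | nil => simp [Within]
    | cons a v => simp [Within]
  | cons a u ih => simp [Within, ih, and_assoc]

lemma within_of_forall {S : Set Q} {p : Q} {u : List Γ}
    (h : ∀ v w, u = v ++ w → M.un p v ∈ S) : M.Within S p u := by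
  induction u generalizing p with
  | nil => exact h [] [] rfl
  | cons a u ih =>
    exact ⟨h [] (a :: u) rfl, ih fun v w hv => h (a :: v) w (by simp [hv])⟩

lemma Within.mem {S : Set Q} {p : Q} {u : List Γ} (h : M.Within S p u) : p ∈ S := by
  cases u with
  | nil => exact h
  | cons a u => exact h.1

/-- Two prefixes of a long word have equal types. -/
lemma exists_repeat {τ : Type} (f : List Γ → τ) (T : Finset τ) {N : ℕ} (hT : T.card ≤ N)
    {w : List Γ} (hw : N ≤ w.length) (hf : ∀ u, f u ∈ T) :
    ∃ u₁ u₂ u₃, w = u₁ ++ u₂ ++ u₃ ∧ 0 < u₂.length ∧ u₂.length ≤ N ∧ f (u₁ ++ u₂) = f u₁ := by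
  obtain ⟨x, hx, y, hy, hxy, he⟩ := Finset.exists_ne_map_eq_of_card_lt_of_maps_to
    (s := Finset.range (N + 1)) (t := T) (f := fun x => f (w.take x)) (by simp; omega)
    (fun x _ => hf _)
  wlog hlt : x < y generalizing x y
  · exact this y hy x hx hxy.symm he.symm (by omega)
  rw [Finset.mem_range] at hx hy
  have h1 : w.take x ++ (w.drop x).take (y - x) = w.take y := by
    rw [← List.take_add, Nat.add_sub_cancel' hlt.le]
  refine ⟨w.take x, (w.drop x).take (y - x), w.drop y, ?_, ?_, ?_, ?_⟩
  · rw [h1, List.take_append_drop]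
  · simp
    omega
  · simp
    omega
  · rw [h1]
    exact he.symm

variable (M)

lemma exists_first_level {p : Q} {m J : ℤ} {w : List Γ} (hJ : J ≤ m) (h : m + M.eff p w ≤ J) :
    ∃ u v, w = u ++ v ∧ m + M.eff p u = J ∧
      ∀ u₁ u₂, u = u₁ ++ u₂ → u₂ ≠ [] → J < m + M.eff p u₁ := by
  induction w generalizing p m with
  | nil =>
    refine ⟨[], [], rfl, ?_, ?_⟩
    · simp at h ⊢
      omega
    · intro u₁ u₂ h1 h2
      simp at h1
      exact absurd h1.2 h2
  | cons a w ih =>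
    rcases hJ.eq_or_lt with h0 | h0
    · refine ⟨[], a :: w, rfl, by simp [h0], ?_⟩
      intro u₁ u₂ h1 h2
      simp at h1
      exact absurd h1.2 h2
    · have hb := M.up_bounds p false a
      rw [eff_cons] at h
      obtain ⟨u, v, rfl, h2, h3⟩ := ih (p := M.nx p false a) (m := m + M.up p false a)
        (by omega) (by omega)
      refine ⟨a :: u, v, rfl, by rw [eff_cons, ← h2]; ring, ?_⟩
      intro u₁ u₂ h4 h5
      cases u₁ with
      | nil => simpa using h0
      | cons b u₁ =>
        simp only [List.cons_append, List.cons.injEq] at h4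
        obtain ⟨rfl, h4⟩ := h4
        have := h3 u₁ u₂ h4 h5
        rw [eff_cons]
        linarith

lemma el_fin_fin_of_lt {p q : Q} {m n : ℕ} (h : M.el (inf p) (inf q) = ⊤)
    (hlt : M.el (fin p m) (inf p) < M.el (fin q n) (inf q)) :
    M.el (fin p m) (fin q n) = M.el (fin p m) (inf p) := by
  rw [M.el_congr_right h] at hlt ⊢
  apply M.el_eq_of_lt
  rwa [M.el_comm (inf q)]

lemma le_el_fin_fin {p q : Q} {m n : ℕ} (h : M.el (inf p) (inf q) = ⊤)
    (he : M.el (fin p m) (inf p) = M.el (fin q n) (inf q)) :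
    M.el (fin p m) (inf p) ≤ M.el (fin p m) (fin q n) := by
  have := M.min_el_le (fin p m) (inf q) (fin q n)
  rwa [← M.el_congr_right h, M.el_comm (inf q), ← he, min_self] at this

variable {M}

/-- If both counters decrease at the same rate, a part of the original witness works. -/
lemma el_le_of_equal_rate {x y : Q} {z v₁ v₂ : List Γ} {β γ : ℤ}
    {m n k m₀ n₀ s : ℕ} (hx : M.un x z = x) (hy : M.un y z = y)
    (hβ : M.eff x z = -β) (hγ : M.eff y z = -γ) (hv₂ : v₂ ≠ [])
    (hm : z.length ≤ m) (hn : z.length ≤ n) (hm₀ : z.length ≤ m₀) (hn₀ : z.length ≤ n₀)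
    (hm' : (m : ℤ) = m₀ - s * β) (hn' : (n : ℤ) = n₀ - s * γ)
    (hw : M.outs (fin x m₀) (wpow z (s + k) ++ v₁ ++ v₂) ≠
      M.outs (fin y n₀) (wpow z (s + k) ++ v₁ ++ v₂))
    (hel : M.el (fin x m₀) (fin y n₀) = ((s + k) * z.length + v₁.length + v₂.length : ℕ)) :
    M.el (fin x m) (fin y n) ≤ (k * z.length + v₁.length + v₂.length : ℕ) := by
  have he : wpow z (s + k) ++ v₁ ++ v₂ = wpow z s ++ (wpow z k ++ v₁ ++ v₂) := by
    rw [wpow_add]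
    simp
  have := (M.el_run_of_append (u := wpow z s) (v := wpow z k ++ v₁ ++ v₂)
    (by rwa [← he]) (by rw [hel, ← he]; simp [add_assoc]) (by simp [hv₂])).2
  rw [run_wpow hx (m' := m) (by omega) (by omega) (by rw [hβ, hm']; ring),
    run_wpow hy (m' := n) (by omega) (by omega) (by rw [hγ, hn']; ring)] at this
  rw [this]
  simp [add_assoc]

variable (M)

variable [Fintype Q]

lemma card_pos_of_state (p : Q) : 0 < Fintype.card Q := Fintype.card_pos_iff.mpr ⟨p⟩

lemma el_inf_inf_le {p q : Q} (h : M.el (inf p) (inf q) ≠ ⊤) :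
    M.el (inf p) (inf q) ≤ (Fintype.card Q ^ 2 : ℕ) := by
  classical
  obtain ⟨L, hL⟩ := ENat.ne_top_iff_exists.mp h
  obtain ⟨g, X, Y, hX0, hY0, hX, hY, hel⟩ := M.exists_minimal_run hL.symm
  obtain ⟨P, hP⟩ := exists_un_traj hX hX0
  obtain ⟨R, hR⟩ := exists_un_traj hY hY0
  have := M.card_le_of_determined hel (Finset.range L) (by simp) (fun i => (P i, R i))
    Finset.univ (by simp) (by
      intro i _ j _ hij
      rw [Prod.mk.injEq] at hij
      rw [hP, hP, hR, hR, hij.1, hij.2])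
  rw [← hL]
  have h2 : L ≤ Fintype.card Q ^ 2 := by
    simpa [sq] using this
  exact_mod_cast h2

lemma el_inf_inf_eq_top {p q : Q} (h : ((Fintype.card Q ^ 2 : ℕ) : ℕ∞) < M.el (inf p) (inf q)) :
    M.el (inf p) (inf q) = ⊤ := by
  by_contra hc
  exact absurd (M.el_inf_inf_le hc) (not_le.mpr h)

/-- A high configuration that is close to a state of the finite machine is close to its own state. -/
lemma el_inf_inf_eq_top_of_lt {p u : Q} {m : ℕ} (hm : Fintype.card Q ^ 2 ≤ m)
    (h : ((Fintype.card Q ^ 2 : ℕ) : ℕ∞) < M.el (fin p m) (inf u)) :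
    M.el (inf p) (inf u) = ⊤ := by
  apply M.el_inf_inf_eq_top
  have h1 := M.min_el_le (inf p) (fin p m) (inf u)
  refine lt_of_lt_of_le (lt_min ?_ h) h1
  rw [M.el_comm]
  exact lt_of_le_of_lt (by exact_mod_cast hm) (M.lt_el_inf p m)

lemma el_fin_inf_eq {p u : Q} {m : ℕ} (hm : Fintype.card Q ^ 2 ≤ m)
    (h : ((Fintype.card Q ^ 2 : ℕ) : ℕ∞) < M.el (fin p m) (inf u)) :
    M.el (fin p m) (inf u) = M.el (fin p m) (inf p) :=
  (M.el_congr_right (M.el_inf_inf_eq_top_of_lt hm h)).symm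

/-- The bound on the distance between a configuration with counter at most `J` and a state of the
finite machine. -/
def bnd (K J : ℕ) : ℕ := K ^ 2 + K ^ 4 + K * (J + K ^ 2)

lemma height_lt_of_minimal {g : ℕ → Γ} {P R : ℕ → Q} {m : ℕ → ℕ} {L J : ℕ}
    (hm : M.Traj g P m) (hm0 : m 0 ≤ J) (hJ : Fintype.card Q ^ 2 ≤ J)
    (hel : ∀ i, i < L → M.el (fin (P i) (m i)) (inf (R i)) = (L - i : ℕ)) {j : ℕ}
    (hj : Fintype.card Q ^ 2 < L - j) : m j < J + Fintype.card Q ^ 2 := by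
  classical
  have hK := card_pos_of_state (P 0)
  set K := Fintype.card Q with hKdef
  have hK2 : 0 < K ^ 2 := by positivity
  have rem : ∀ i, K ^ 2 < L - i → K ^ 2 ≤ m i →
      M.el (fin (P i) (m i)) (inf (P i)) = (L - i : ℕ) := by
    intro i hi hmi
    rw [← hel i (by omega)]
    refine (M.el_fin_inf_eq hmi ?_).symm
    rw [hel i (by omega)]
    exact_mod_cast hi
  have hend : m (L - (K ^ 2 + 1)) ≤ J := by
    by_contra hc
    have h1 := rem (L - (K ^ 2 + 1)) (by omega) (by omega)
    have h2 := M.lt_el_inf (P (L - (K ^ 2 + 1))) (m (L - (K ^ 2 + 1)))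
    rw [h1] at h2
    have h2 : m (L - (K ^ 2 + 1)) < L - (L - (K ^ 2 + 1)) := by exact_mod_cast h2
    omega
  by_contra hc
  obtain ⟨a, b, c, d, -, hab, hbc, hcd, hde, hl, hlt, hda, hcb, fab, fcd, hb, -⟩ :=
    hm.slow.exists_up_down (i := 0) (j := j) (e := L - (K ^ 2 + 1)) (l := J) (N := K ^ 2)
      (by omega) (by omega) hm0 hend (by omega) P Finset.univ (by simp)
      (by rw [Finset.card_univ])
  have ha := rem a (by omega) (by omega)
  have hd := rem d (by omega) (by omega)
  have h1 := M.el_le_run (fin (P a) (m a)) (inf (P a)) (seg g b (c - b))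
  have h2 := hm.run_seg_sub b (c - b) (m b - m a) fun k hk hk' => by
    have := hb k hk (by omega)
    omega
  have h3 := hm.un_seg b (c - b) fun k hk hk' => by
    have := hb k hk (by omega)
    omega
  rw [Nat.sub_sub_self hlt.le, Nat.add_sub_cancel' hbc, hcb, Nat.sub_sub_self hlt.le, fcd,
    ← hda, ← fab] at h2
  rw [Nat.add_sub_cancel' hbc, fcd, ← fab] at h3
  rw [ha] at h1
  rw [← hda, h2, run_inf, h3, hd, length_seg] at h1
  have : L - a ≤ c - b + (L - d) := by exact_mod_cast h1
  omega

lemma el_fin_inf_le {p u : Q} {m J : ℕ} (hm : m ≤ J) (hJ : Fintype.card Q ^ 2 ≤ J)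
    (h : M.el (fin p m) (inf u) ≠ ⊤) :
    M.el (fin p m) (inf u) ≤ bnd (Fintype.card Q) J := by
  classical
  obtain ⟨L, hL⟩ := ENat.ne_top_iff_exists.mp h
  obtain ⟨g, X, Y, hX0, hY0, hX, hY, hel⟩ := M.exists_minimal_run hL.symm
  obtain ⟨P, m', hT, hP⟩ := exists_traj hX hX0
  obtain ⟨R, hR⟩ := exists_un_traj hY hY0
  have hm0 : m' 0 ≤ J := by
    have := hP 0
    rw [hX0, fin.injEq] at this
    omega
  have hel' : ∀ i, i < L → M.el (fin (P i) (m' i)) (inf (R i)) = (L - i : ℕ) := by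
    intro i hi
    rw [← hP, ← hR, hel i hi]
  set K := Fintype.card Q with hKdef
  set s := Finset.range L
  have c1 : (s.filter fun i => L - i ≤ K ^ 2).card ≤ K ^ 2 := by
    have := M.card_le_of_determined hel (s.filter fun i => L - i ≤ K ^ 2) (by simp +contextual [s])
      (fun i => L - i) (Finset.Icc 1 (K ^ 2)) (by simp [s]; omega) (by
        intro i hi j hj hij
        simp [s] at hi hj
        rw [hel i hi.1, hel j hj.1, hij])
    simpa using this
  have c2 : (s.filter fun i => m' i < K ^ 2).card ≤ K ^ 4 := by
    have := M.card_le_of_determined hel (s.filter fun i => m' i < K ^ 2) (by simp +contextual [s])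
      (fun i => (P i, R i, m' i)) (Finset.univ ×ˢ Finset.univ ×ˢ Finset.range (K ^ 2))
      (by simp) (by
        intro i _ j _ hij
        simp only [Prod.mk.injEq] at hij
        rw [hP, hP, hR, hR, hij.1, hij.2.1, hij.2.2])
    simp only [Finset.card_product, Finset.card_univ, Finset.card_range, ← hKdef] at this
    calc _ ≤ _ := this
      _ = _ := by ring
  have c3 : (s.filter fun i => K ^ 2 < L - i ∧ K ^ 2 ≤ m' i).card ≤ K * (J + K ^ 2) := by
    have := M.card_le_of_determined hel (s.filter fun i => K ^ 2 < L - i ∧ K ^ 2 ≤ m' i)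
      (by simp +contextual [s])
      (fun i => (P i, m' i)) (Finset.univ ×ˢ Finset.range (J + K ^ 2))
      (by
        intro i hi
        simp only [Finset.mem_filter] at hi
        simpa using M.height_lt_of_minimal hT hm0 hJ hel' hi.2.1) (by
        have key : ∀ i ∈ s.filter fun i => K ^ 2 < L - i ∧ K ^ 2 ≤ m' i,
            M.el (X i) (Y i) = M.el (fin (P i) (m' i)) (inf (P i)) := by
          intro i hi
          simp only [Finset.mem_filter, s, Finset.mem_range] at hi
          rw [hP, hR]
          apply M.el_fin_inf_eq hi.2.2
          rw [hel' i hi.1]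
          exact_mod_cast hi.2.1
        intro i hi j hj hij
        simp only [Prod.mk.injEq] at hij
        rw [key i hi, key j hj, hij.1, hij.2])
    simpa using this
  have hu : s ⊆ (s.filter fun i => L - i ≤ K ^ 2) ∪ (s.filter fun i => m' i < K ^ 2) ∪
      (s.filter fun i => K ^ 2 < L - i ∧ K ^ 2 ≤ m' i) := by
    intro i hi
    simp only [Finset.mem_union, Finset.mem_filter, hi, true_and]
    omega
  have h1 := Finset.card_le_card hu
  have h2 := Finset.card_union_le ((s.filter fun i => L - i ≤ K ^ 2) ∪
    (s.filter fun i => m' i < K ^ 2)) (s.filter fun i => K ^ 2 < L - i ∧ K ^ 2 ≤ m' i)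
  have h3 := Finset.card_union_le (s.filter fun i => L - i ≤ K ^ 2)
    (s.filter fun i => m' i < K ^ 2)
  rw [show s.card = L from Finset.card_range L] at h1
  rw [← hL]
  have : L ≤ bnd K J := by
    unfold bnd
    omega
  exact_mod_cast this

variable {M}

/-- A word containing a removable closed infix. -/
lemma exists_loop (p : Q) {w : List Γ} (hw : Fintype.card Q ≤ w.length) :
    ∃ u₁ u₂ u₃, w = u₁ ++ u₂ ++ u₃ ∧ 0 < u₂.length ∧ u₂.length ≤ Fintype.card Q ∧
      M.un (M.un p u₁) u₂ = M.un p u₁ := by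
  obtain ⟨u₁, u₂, u₃, h1, h2, h3, h4⟩ :=
    exists_repeat (M.un p) Finset.univ (N := Fintype.card Q) (by simp) hw (by simp)
  exact ⟨u₁, u₂, u₃, h1, h2, h3, by rw [← un_append, h4]⟩

lemma neg_card_le_eff {S : Set Q}
    (hS : ∀ x ∈ S, ∀ z, M.un x z = x → z.length ≤ Fintype.card Q → 0 ≤ M.eff x z)
    {p : Q} {w : List Γ} (hw : M.Within S p w) : -(Fintype.card Q : ℤ) ≤ M.eff p w := by
  induction hn : w.length using Nat.strong_induction_on generalizing w with
  | _ n ih =>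
    rcases le_total w.length (Fintype.card Q) with hl | hl
    · have := M.eff_bounds p w
      omega
    · obtain ⟨u₁, u₂, u₃, rfl, h2, h3, h4⟩ := M.exists_loop p hl
      rw [List.append_assoc, within_append, within_append, h4] at hw
      have h5 := hS _ hw.2.1.mem u₂ h4 h3
      have h6 := ih (u₁ ++ u₃).length (by simp at hn ⊢; omega)
        (within_append.mpr ⟨hw.1, hw.2.2⟩) rfl
      rw [eff_append, eff_append, un_append, h4]
      rw [eff_append] at h6
      linarith

lemma closed_weight_nonneg {S : Set Q} {α β : ℤ}
    (hS : ∀ x ∈ S, ∀ z, M.un x z = x → z.length ≤ Fintype.card Q →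
      0 ≤ β * z.length + α * M.eff x z)
    {p : Q} {w : List Γ} (hw : M.Within S p w) (hc : M.un p w = p) :
    0 ≤ β * w.length + α * M.eff p w := by
  induction hn : w.length using Nat.strong_induction_on generalizing w with
  | _ n ih =>
    rcases le_total w.length (Fintype.card Q) with hl | hl
    · rw [← hn]
      exact hS p hw.mem w hc hl
    · obtain ⟨u₁, u₂, u₃, rfl, h2, h3, h4⟩ := M.exists_loop p hl
      rw [List.append_assoc, within_append, within_append, h4] at hw
      have h5 := hS _ hw.2.1.mem u₂ h4 h3
      have h6 := ih (u₁ ++ u₃).length (by simp at hn ⊢; omega)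
        (within_append.mpr ⟨hw.1, hw.2.2⟩)
        (by rw [un_append]; rwa [un_append, un_append, h4] at hc) rfl
      rw [← hn, eff_append, eff_append, un_append, h4]
      rw [eff_append] at h6
      simp only [List.length_append, Nat.cast_add] at h6 ⊢
      linarith

/-- Shortening a walk without increasing its weight, keeping its effect modulo `β`. -/
lemma exists_short_walk {S : Set Q} {α : ℤ} {β : ℕ} (hβ : 0 < β)
    (hS : ∀ x ∈ S, ∀ z, M.un x z = x → z.length ≤ Fintype.card Q →
      0 ≤ (β : ℤ) * z.length + α * M.eff x z)
    {p : Q} {w : List Γ} (hw : M.Within S p w) :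
    ∃ v, M.un p v = M.un p w ∧ v.length ≤ Fintype.card Q * β ∧ (β : ℤ) ∣ M.eff p w - M.eff p v ∧
      (β : ℤ) * v.length + α * M.eff p v ≤ β * w.length + α * M.eff p w := by
  classical
  induction hn : w.length using Nat.strong_induction_on generalizing w with
  | _ n ih =>
    rcases le_total w.length (Fintype.card Q * β) with hl | hl
    · exact ⟨w, rfl, hl, by simp, by rw [hn]⟩
    · obtain ⟨u₁, u₂, u₃, rfl, h2, h3, h4⟩ :=
        exists_repeat (fun u => (M.un p u, M.eff p u % β)) (Finset.univ ×ˢ Finset.Ico 0 (β : ℤ))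
          (N := Fintype.card Q * β) (by simp) hl (by
            intro u
            have h1 := Int.emod_nonneg (M.eff p u) (by omega : (β : ℤ) ≠ 0)
            have h2 := Int.emod_lt_of_pos (M.eff p u) (by omega : (0 : ℤ) < β)
            simp [h1, h2])
      rw [Prod.mk.injEq, un_append, eff_append] at h4
      obtain ⟨h4, h4'⟩ := h4
      have hdvd : (β : ℤ) ∣ M.eff (M.un p u₁) u₂ := by
        have := Int.ModEq.dvd (Int.ModEq.symm h4' : M.eff p u₁ ≡ _ [ZMOD β])
        simpa using this
      rw [List.append_assoc, within_append, within_append, h4] at hw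
      have h5 := closed_weight_nonneg hS hw.2.1 h4
      obtain ⟨v, e1, e2, e3, e4⟩ := ih (u₁ ++ u₃).length (by simp at hn ⊢; omega)
        (within_append.mpr ⟨hw.1, hw.2.2⟩) rfl
      refine ⟨v, ?_, e2, ?_, ?_⟩
      · rw [e1, un_append, un_append, un_append, h4]
      · have := dvd_add e3 hdvd
        rw [eff_append] at this
        rw [eff_append, eff_append, un_append, h4]
        rwa [sub_add_eq_add_sub, add_right_comm] at this
      · refine e4.trans ?_
        rw [← hn, eff_append, eff_append, un_append, h4, eff_append]
        simp only [List.length_append, Nat.cast_add]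
        linarith

/-- A walk with large negative effect can be replaced by a not longer one with the same effect
that mostly iterates one short loop. -/
lemma exists_iterated_loop {p : Q} {w : List Γ}
    (hw : 2 * (Fintype.card Q : ℤ) ^ 2 < -M.eff p w) :
    ∃ (x : Q) (z v₀ v₁ : List Γ) (k β : ℕ), M.un p v₀ = x ∧ M.un x z = x ∧
      M.un x v₁ = M.un p w ∧ z.length ≤ Fintype.card Q ∧ 1 ≤ β ∧ M.eff x z = -β ∧
      v₀.length ≤ Fintype.card Q ^ 2 ∧ v₁.length ≤ Fintype.card Q ^ 2 ∧
      M.eff p v₀ - k * β + M.eff x v₁ = M.eff p w ∧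
      v₀.length + k * z.length + v₁.length ≤ w.length := by
  classical
  have hK := card_pos_of_state p
  set K := Fintype.card Q with hKdef
  set S : Set Q := {x | ∃ v u, w = v ++ u ∧ M.un p v = x} with hSdef
  have hSw : M.Within S p w := within_of_forall fun v u hvu => ⟨v, u, hvu, rfl⟩
  let P : ℕ × ℕ → Prop := fun c => ∃ x ∈ S, ∃ z : List Γ, M.un x z = x ∧ z.length = c.1 ∧
    M.eff x z = -(c.2 : ℤ) ∧ 1 ≤ c.2
  let F : Finset (ℕ × ℕ) := ((Finset.range (K + 1)) ×ˢ (Finset.range (K + 1))).filter P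
  have hF : ∀ x ∈ S, ∀ z, M.un x z = x → z.length ≤ K → M.eff x z < 0 →
      (z.length, (-M.eff x z).toNat) ∈ F := by
    intro x hx z hz hl he
    have hb := M.eff_bounds x z
    simp only [F, Finset.mem_filter, Finset.mem_product, Finset.mem_range, P]
    exact ⟨⟨by omega, by omega⟩, x, hx, z, hz, rfl, by omega, by omega⟩
  have hne : F.Nonempty := by
    by_contra hc
    rw [Finset.not_nonempty_iff_eq_empty] at hc
    have h1 := neg_card_le_eff (S := S) (fun x hx z hz hl => by
      by_contra hlt
      have := hF x hx z hz hl (by omega)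
      simp [hc] at this) hSw
    rw [← hKdef] at h1
    have : (K : ℤ) ≤ (K : ℤ) ^ 2 := by exact_mod_cast Nat.le_self_pow (by norm_num) K
    omega
  obtain ⟨⟨α, β⟩, hmem, hmin⟩ := Finset.exists_min_image F (fun c => (c.1 : ℚ) / c.2) hne
  have hmem' := hmem
  simp only [F, Finset.mem_filter, Finset.mem_product, Finset.mem_range, P] at hmem'
  obtain ⟨⟨hαK, hβK⟩, x, ⟨π₁, π₂, hπ, hx⟩, z, hz, hzl, hze, hβ⟩ := hmem'
  have hS : ∀ y ∈ S, ∀ u, M.un y u = y → u.length ≤ K →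
      0 ≤ (β : ℤ) * u.length + (α : ℤ) * M.eff y u := by
    intro y hy u hu hl
    rcases le_or_gt 0 (M.eff y u) with h0 | h0
    · positivity
    · have h1 := hmin _ (hF y hy u hu hl h0)
      have hc : (((-M.eff y u).toNat : ℕ) : ℤ) = -M.eff y u := by omega
      simp only at h1
      rw [div_le_div_iff₀ (by exact_mod_cast hβ) (by
        have : 0 < (-M.eff y u).toNat := by omega
        exact_mod_cast this)] at h1
      have h2 : (α : ℤ) * ((-M.eff y u).toNat : ℕ) ≤ u.length * β := by exact_mod_cast h1
      rw [hc] at h2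
      linarith
  rw [hπ, within_append, hx] at hSw
  obtain ⟨v₀, a1, a2, ⟨a, a3⟩, a4⟩ := exists_short_walk hβ hS hSw.1
  obtain ⟨v₁, b1, b2, ⟨b, b3⟩, b4⟩ := exists_short_walk hβ hS hSw.2
  rw [← hKdef] at a2 b2
  have hKβ : K * β ≤ K ^ 2 := by
    rw [sq]
    exact Nat.mul_le_mul le_rfl (by omega)
  have hwe : M.eff p w = M.eff p π₁ + M.eff x π₂ := by rw [hπ, eff_append, hx]
  have e0 := M.eff_bounds p v₀
  have e1 := M.eff_bounds x v₁
  have hl0 : (v₀.length : ℤ) ≤ (K : ℤ) ^ 2 := by exact_mod_cast a2.trans hKβ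
  have hl1 : (v₁.length : ℤ) ≤ (K : ℤ) ^ 2 := by exact_mod_cast b2.trans hKβ
  have hneg : (β : ℤ) * (a + b) < 0 := by
    have : (β : ℤ) * (a + b) = M.eff p w - M.eff p v₀ - M.eff x v₁ := by
      rw [hwe]
      linarith
    rw [this]
    linarith
  have hab : a + b < 0 := by
    by_contra hc
    have : 0 ≤ (β : ℤ) * (a + b) := mul_nonneg (by positivity) (by omega)
    omega
  have hk : (((-(a + b)).toNat : ℕ) : ℤ) = -(a + b) := by omega
  refine ⟨x, z, v₀, v₁, (-(a + b)).toNat, β, a1.trans hx, hz, ?_, by omega, hβ, hze,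
    a2.trans hKβ, b2.trans hKβ, ?_, ?_⟩
  · rw [b1, hπ, un_append, hx]
  · rw [hk, hwe]
    linarith
  · zify
    rw [hk, hzl, hπ]
    simp only [List.length_append, Nat.cast_add]
    have hβ' : (0 : ℤ) < β := by omega
    refine le_of_mul_le_mul_left ?_ hβ'
    have : (α : ℤ) * (M.eff p π₁ + M.eff x π₂ - M.eff p v₀ - M.eff x v₁)
        = α * (β * (a + b)) := by
      congr 1
      linarith
    linarith

variable (M)

/-- A shortest word `v₀ ++ wpow z k ++ v₁ ++ v₂` distinguishing a high configuration from its
state; the loop `z` decreases the counter by `β`, and before `v₂` the counter is `5 * card Q ^ 2`. -/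
structure Descent (p : Q) (m : ℕ) where
  x : Q
  r : Q
  z : List Γ
  v₀ : List Γ
  v₁ : List Γ
  v₂ : List Γ
  k : ℕ
  β : ℕ
  un_v₀ : M.un p v₀ = x
  un_z : M.un x z = x
  un_v₁ : M.un x v₁ = r
  length_z : z.length ≤ Fintype.card Q
  one_le_β : 1 ≤ β
  eff_z : M.eff x z = -β
  length_v₀ : v₀.length ≤ Fintype.card Q ^ 2
  length_v₁ : v₁.length ≤ Fintype.card Q ^ 2
  level : (m : ℤ) + M.eff p v₀ - k * β + M.eff x v₁ = 5 * Fintype.card Q ^ 2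
  outs_ne : M.outs (fin r (5 * Fintype.card Q ^ 2)) v₂ ≠ M.outs (inf r) v₂
  length_v₂ : v₂.length ≤ bnd (Fintype.card Q) (5 * Fintype.card Q ^ 2)
  el_eq : M.el (fin p m) (inf p) = (v₀.length + k * z.length + v₁.length + v₂.length : ℕ)

variable {M}

lemma exists_descent {p : Q} {m : ℕ} (hm : 10 * Fintype.card Q ^ 2 ≤ m)
    (h : M.el (fin p m) (inf p) ≠ ⊤) : Nonempty (M.Descent p m) := by
  have hK := card_pos_of_state p
  obtain ⟨w, hw, hl⟩ := M.exists_word h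
  obtain ⟨v, w', hvw, hw', hv⟩ := M.exists_prefix_of_outs_ne hw
  set K := Fintype.card Q with hKdef
  have hK2 : 0 < K ^ 2 := by positivity
  have hKK : K ≤ K ^ 2 := Nat.le_self_pow (by norm_num) K
  obtain ⟨u, ρ, hu, hJ, hpos⟩ := M.exists_first_level (p := p) (m := m) (J := 5 * (K ^ 2 : ℕ))
    (w := v) (by omega) (by omega)
  have hρ : ρ ++ w' ≠ [] := by simp [hw']
  have hwu : w = u ++ (ρ ++ w') := by rw [hvw, hu, List.append_assoc]
  have hrun := (M.run_outs_of_pos p m u fun u₁ u₂ h1 h2 => by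
    have := hpos u₁ u₂ h1 h2
    omega).1
  rw [hJ] at hrun
  have hrun : M.run (fin p m) u = fin (M.un p u) (5 * K ^ 2) := by
    rw [hrun]
    congr 1
  have hel := M.el_run_of_append (x := fin p m) (y := inf p) (u := u) (v := ρ ++ w')
    (by rwa [← hwu]) (by rw [← hwu, hl]) hρ
  rw [hrun, run_inf] at hel
  have hv2 : (ρ ++ w').length ≤ bnd K (5 * K ^ 2) := by
    have := M.el_fin_inf_le (p := M.un p u) (u := M.un p u) (m := 5 * K ^ 2) (J := 5 * K ^ 2) le_rfl
      (by rw [← hKdef]; omega) (by rw [hel.2]; exact ENat.natCast_ne_top _)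
    rw [hel.2] at this
    exact_mod_cast this
  obtain ⟨x, z, v₀, v₁, k, β, h1, h2, h3, h4, h5, h6, h7, h8, h9, h10⟩ :=
    M.exists_iterated_loop (p := p) (w := u) (by
      rw [← hKdef]
      have : ((K ^ 2 : ℕ) : ℤ) = (K : ℤ) ^ 2 := by push_cast; rfl
      omega)
  have hlev : (m : ℤ) + M.eff p v₀ - k * β + M.eff x v₁ = 5 * (K ^ 2 : ℕ) := by
    rw [← hJ, ← h9]
    ring
  refine ⟨⟨x, M.un p u, z, v₀, v₁, ρ ++ w', k, β, h1, h2, h3, h4, h5, h6, h7, h8,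
    by rw [hlev]; push_cast; rfl, hel.1, hv2, ?_⟩⟩
  apply le_antisymm
  · have e0 := M.eff_bounds p v₀
    have e1 := M.eff_bounds x v₁
    rw [← hKdef] at h4 h7 h8
    obtain ⟨m₁, hm₁⟩ : ∃ m₁ : ℕ, (m₁ : ℤ) = m + M.eff p v₀ :=
      ⟨(m + M.eff p v₀).toNat, by omega⟩
    have heq : (m₁ : ℤ) + k * M.eff x z = 5 * (K ^ 2 : ℕ) - M.eff x v₁ := by
      rw [h6, hm₁]
      linarith
    obtain ⟨m₂, hm₂⟩ : ∃ m₂ : ℕ, (m₂ : ℤ) = m₁ + k * M.eff x z :=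
      ⟨(5 * (K ^ 2 : ℕ) - M.eff x v₁).toNat, by omega⟩
    have hm2 : (m₂ : ℤ) = 5 * (K ^ 2 : ℕ) - M.eff x v₁ := hm₂.trans heq
    have r0 : M.run (fin p m) v₀ = fin x m₁ := by rw [M.run_fin (by omega) hm₁, h1]
    have r1 : M.run (fin x m₁) (wpow z k) = fin x m₂ := run_wpow h2 (by omega) (by omega) hm₂
    have r2 : M.run (fin x m₂) v₁ = fin (M.un p u) (5 * K ^ 2) := by
      rw [M.run_fin (by omega) (m' := 5 * K ^ 2) (by push_cast at hm2 ⊢; omega), h3]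
    have hne : M.outs (fin p m) ((v₀ ++ wpow z k ++ v₁) ++ (ρ ++ w')) ≠
        M.outs (inf p) ((v₀ ++ wpow z k ++ v₁) ++ (ρ ++ w')) := by
      apply M.outs_append_ne
      simp only [run_append, r0, r1, r2, run_inf, h1, un_wpow h2, h3]
      exact hel.1
    refine (M.el_le hne).trans (le_of_eq ?_)
    simp only [List.length_append, length_wpow]
  · rw [hl, hwu]
    simp only [List.length_append] at h10 ⊢
    exact_mod_cast (by omega)

namespace Descent

variable {p : Q} {m : ℕ}

lemma β_le_length (δ : M.Descent p m) : δ.β ≤ δ.z.length := by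
  have h1 := M.eff_bounds δ.x δ.z
  rw [δ.eff_z] at h1
  omega

/-- The length of the witness. -/
def len (δ : M.Descent p m) : ℕ :=
  δ.v₀.length + δ.k * δ.z.length + δ.v₁.length + δ.v₂.length

lemma el_eq_len (δ : M.Descent p m) : M.el (fin p m) (inf p) = δ.len := δ.el_eq

lemma belt (δ : M.Descent p m) :
    |(δ.β : ℤ) * δ.len - δ.z.length * m| ≤ δ.β * (20 * (Fintype.card Q : ℤ) ^ 4) := by
  have hK := card_pos_of_state p
  have e0 := M.eff_bounds p δ.v₀
  have e1 := M.eff_bounds δ.x δ.v₁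
  have h0 := δ.length_v₀
  have h1 := δ.length_v₁
  have h2 := δ.length_v₂
  have hz := δ.length_z
  have hβ := δ.one_le_β
  have hlev := δ.level
  unfold bnd at h2
  unfold len
  set K := Fintype.card Q with hKdef
  generalize M.eff p δ.v₀ = E₀ at *
  generalize M.eff δ.x δ.v₁ = E₁ at *
  generalize δ.v₀.length = l₀ at *
  generalize δ.v₁.length = l₁ at *
  generalize δ.v₂.length = l₂ at *
  generalize δ.z.length = α at *
  generalize δ.β = β at *
  generalize δ.k = k at *
  have hm : (m : ℤ) = 5 * (K : ℤ) ^ 2 + k * β - E₀ - E₁ := by linarith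
  have hid : (β : ℤ) * (l₀ + k * α + l₁ + l₂ : ℕ) - α * m =
      β * (l₀ + l₁ + l₂) + α * (E₀ + E₁ - 5 * (K : ℤ) ^ 2) := by
    rw [hm]
    push_cast
    ring
  rw [hid]
  zify at h0 h1 h2 hz hβ hK
  have k2 : (1 : ℤ) ≤ (K : ℤ) ^ 2 := by nlinarith
  have k3 : (K : ℤ) ^ 2 ≤ (K : ℤ) ^ 3 := by nlinarith
  have k4 : (K : ℤ) ^ 3 ≤ (K : ℤ) ^ 4 := by nlinarith
  have hs : 0 ≤ (β : ℤ) * (l₀ + l₁ + l₂) ∧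
      (β : ℤ) * (l₀ + l₁ + l₂) ≤ β * (10 * (K : ℤ) ^ 4) := by
    refine ⟨by positivity, mul_le_mul_of_nonneg_left ?_ (by positivity)⟩
    nlinarith
  have hα : (α : ℤ) ≤ β * K := by nlinarith
  have ht : |(α : ℤ) * (E₀ + E₁ - 5 * (K : ℤ) ^ 2)| ≤ β * (7 * (K : ℤ) ^ 4) := by
    rw [abs_mul, abs_of_nonneg (by positivity : (0 : ℤ) ≤ α)]
    have : |E₀ + E₁ - 5 * (K : ℤ) ^ 2| ≤ 7 * (K : ℤ) ^ 2 := by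
      rw [abs_le]
      constructor <;> linarith
    calc (α : ℤ) * |E₀ + E₁ - 5 * (K : ℤ) ^ 2| ≤ (β * K) * (7 * (K : ℤ) ^ 2) :=
          mul_le_mul hα this (abs_nonneg _) (by positivity)
      _ = β * (7 * (K : ℤ) ^ 3) := by ring
      _ ≤ β * (7 * (K : ℤ) ^ 4) := mul_le_mul_of_nonneg_left (by linarith) (by positivity)
  rw [abs_le] at ht ⊢
  have : 0 ≤ (β : ℤ) * (K : ℤ) ^ 4 := by positivity
  constructor <;> linarith

lemma len_le (δ : M.Descent p m) :
    δ.len ≤ Fintype.card Q * m + 20 * Fintype.card Q ^ 4 := by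
  have h := (abs_le.mp δ.belt).2
  have hβ := δ.one_le_β
  have hz := δ.length_z
  zify at hβ hz ⊢
  have h1 : (δ.z.length : ℤ) * m ≤ δ.β * (Fintype.card Q * m) := by
    rw [← mul_assoc]
    refine mul_le_mul_of_nonneg_right ?_ (by positivity)
    nlinarith
  have h2 : (δ.β : ℤ) * δ.len ≤
      δ.β * (Fintype.card Q * m + 20 * (Fintype.card Q : ℤ) ^ 4) := by
    rw [mul_add]
    linarith
  exact le_of_mul_le_mul_left h2 (by linarith)

end Descent

lemma le_of_mul_le_mul_of_le {c D B X : ℤ} (hc : 1 ≤ c) (hD : c ≤ D) (hB : 0 ≤ B)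
    (h : D * B ≤ c * X) : B ≤ X := by
  by_contra! hX
  have h1 := mul_le_mul_of_nonneg_right hD hB
  have h2 := mul_lt_mul_of_pos_left hX (by linarith : 0 < c)
  linarith

section Pump

variable {x y r : Q} {z v₁ v₂ : List Γ} {β : ℕ} {γ : ℤ}

/-- The word `wpow z k ++ v₁ ++ v₂` distinguishes a configuration from its state, provided the
counter is `5 * card Q ^ 2` before `v₂`. -/
lemma run_level {m k : ℕ} (hx : M.un x z = x) (hr : M.un x v₁ = r) (hβ : M.eff x z = -β)
    (hz : z.length ≤ Fintype.card Q ^ 2) (hv₁ : v₁.length ≤ 2 * Fintype.card Q ^ 2)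
    (hm : Fintype.card Q ^ 2 ≤ m)
    (hlev : (m : ℤ) - k * β + M.eff x v₁ = 5 * Fintype.card Q ^ 2) :
    M.run (fin x m) (wpow z k ++ v₁) = fin r (5 * Fintype.card Q ^ 2) := by
  have e1 := M.eff_bounds x v₁
  have hc : ((Fintype.card Q ^ 2 : ℕ) : ℤ) = (Fintype.card Q : ℤ) ^ 2 := by push_cast; rfl
  obtain ⟨m', hm'⟩ : ∃ m' : ℕ, (m' : ℤ) = m - k * β :=
    ⟨((m : ℤ) - k * β).toNat, by omega⟩
  rw [run_append, run_wpow hx (m' := m') (by omega) (by omega) (by rw [hβ, hm']; ring),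
    M.run_fin (m' := 5 * Fintype.card Q ^ 2) (by omega) (by push_cast; omega), hr]

lemma outs_ne_of_level {m k : ℕ} (hx : M.un x z = x) (hr : M.un x v₁ = r) (hβ : M.eff x z = -β)
    (hz : z.length ≤ Fintype.card Q ^ 2) (hv₁ : v₁.length ≤ 2 * Fintype.card Q ^ 2)
    (hm : Fintype.card Q ^ 2 ≤ m)
    (hlev : (m : ℤ) - k * β + M.eff x v₁ = 5 * Fintype.card Q ^ 2)
    (hne : M.outs (fin r (5 * Fintype.card Q ^ 2)) v₂ ≠ M.outs (inf r) v₂) :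
    M.outs (fin x m) (wpow z k ++ v₁ ++ v₂) ≠ M.outs (inf x) (wpow z k ++ v₁ ++ v₂) := by
  apply M.outs_append_ne
  rw [run_level hx hr hβ hz hv₁ hm hlev, run_inf, un_append, un_wpow hx, hr]
  exact hne

/-- If the second counter decreases more slowly than the first, it plays no role. -/
lemma el_le_of_slow {m n k n₂ : ℕ} (hx : M.un x z = x) (hy : M.un y z = y) (hr : M.un x v₁ = r)
    (hβ : M.eff x z = -β) (hγ : M.eff y z = -γ)
    (hz : z.length ≤ Fintype.card Q ^ 2) (hv₁ : v₁.length ≤ 2 * Fintype.card Q ^ 2)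
    (hm : Fintype.card Q ^ 2 ≤ m) (hn : Fintype.card Q ^ 2 ≤ n)
    (hlev : (m : ℤ) - k * β + M.eff x v₁ = 5 * Fintype.card Q ^ 2)
    (hne : M.outs (fin r (5 * Fintype.card Q ^ 2)) v₂ ≠ M.outs (inf r) v₂)
    (hinf : M.el (inf x) (inf y) = ⊤)
    (hn₂ : (n₂ : ℤ) = n - k * γ) (hlarge : 2 * Fintype.card Q ^ 2 + v₂.length ≤ n₂) :
    M.el (fin x m) (fin y n) ≤ (k * z.length + v₁.length + v₂.length : ℕ) := by
  have e1 := M.eff_bounds y v₁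
  obtain ⟨n₃, hn₃⟩ : ∃ n₃ : ℕ, (n₃ : ℤ) = n₂ + M.eff y v₁ :=
    ⟨((n₂ : ℤ) + M.eff y v₁).toNat, by omega⟩
  have hne' : M.outs (fin x m) ((wpow z k ++ v₁) ++ v₂) ≠
      M.outs (fin y n) ((wpow z k ++ v₁) ++ v₂) := by
    apply M.outs_append_ne
    rw [run_level hx hr hβ hz hv₁ hm hlev, run_append,
      run_wpow hy (m' := n₂) (by omega) (by omega) (by rw [hγ, hn₂]; ring),
      M.run_fin (m' := n₃) (by omega) hn₃, M.outs_fin (p := M.un y v₁) (m := n₃) (by omega)]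
    have := M.el_run_eq_top hinf v₁
    rw [run_inf, run_inf, hr] at this
    rw [← M.outs_eq_of_lt (x := inf r) (y := inf (M.un y v₁)) (w := v₂)
      (by rw [this]; exact ENat.natCast_lt_top _)]
    exact hne
  refine (M.el_le hne').trans (le_of_eq ?_)
  simp [add_assoc]

/-- If the second counter decreases faster than the first, it reaches a configuration that is
equivalent to the state of the first one. -/
lemma el_le_of_fast {m n k m₀ n₀ μ μ₀ l m₁ m₂ e : ℕ}
    (hx : M.un x z = x) (hy : M.un y z = y)
    (hr : M.un x v₁ = r) (hβ : M.eff x z = -β) (hγ : M.eff y z = -γ)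
    (hz : z.length ≤ Fintype.card Q ^ 2) (hv₁ : v₁.length ≤ 2 * Fintype.card Q ^ 2)
    (hm : Fintype.card Q ^ 2 ≤ m) (hn : Fintype.card Q ^ 2 ≤ n)
    (hm₀ : Fintype.card Q ^ 2 ≤ m₀) (hn₀ : Fintype.card Q ^ 2 ≤ n₀)
    (hlev : (m : ℤ) - k * β + M.eff x v₁ = 5 * Fintype.card Q ^ 2)
    (hne : M.outs (fin r (5 * Fintype.card Q ^ 2)) v₂ ≠ M.outs (inf r) v₂)
    (hl : (l : ℤ) = n - μ * γ) (hl₀ : (l : ℤ) = n₀ - μ₀ * γ)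
    (hl5 : 5 * Fintype.card Q ^ 2 ≤ l) (hl6 : l ≤ 6 * Fintype.card Q ^ 2)
    (hm₁ : (m₁ : ℤ) = m₀ - μ₀ * β) (hm₂ : (m₂ : ℤ) = m - μ * β) (hμ : μ ≤ k)
    (hm₁' : 9 * Fintype.card Q ^ 4 ≤ m₁) (hm₂' : Fintype.card Q ^ 2 ≤ m₂)
    (he : 9 * Fintype.card Q ^ 4 < e)
    (hel : ((μ₀ * z.length + e : ℕ) : ℕ∞) ≤ M.el (fin x m₀) (fin y n₀)) :
    M.el (fin x m) (fin y n) ≤ (k * z.length + v₁.length + v₂.length : ℕ) := by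
  have hK := card_pos_of_state x
  have hK4 : Fintype.card Q ^ 2 ≤ Fintype.card Q ^ 4 := Nat.pow_le_pow_right hK (by norm_num)
  have hK34 : Fintype.card Q ^ 3 ≤ Fintype.card Q ^ 4 := Nat.pow_le_pow_right hK (by norm_num)
  have hb : bnd (Fintype.card Q) (6 * Fintype.card Q ^ 2) ≤ 9 * Fintype.card Q ^ 4 := by
    have : bnd (Fintype.card Q) (6 * Fintype.card Q ^ 2) =
        Fintype.card Q ^ 2 + Fintype.card Q ^ 4 + 7 * Fintype.card Q ^ 3 := by
      unfold bnd
      ring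
    omega
  have htop : M.el (fin y l) (inf x) = ⊤ := by
    by_contra hc
    have h1 := M.el_fin_inf_le hl6 (by omega) hc
    have h2 := M.el_le_run (fin x m₀) (fin y n₀) (wpow z μ₀)
    rw [run_wpow hx (m' := m₁) (by omega) (by omega) (by rw [hβ, hm₁]; ring),
      run_wpow hy (m' := l) (by omega) (by omega) (by rw [hγ, hl₀]; ring), length_wpow] at h2
    have h3 := hel.trans h2
    rw [Nat.cast_add] at h3
    have h4 := (ENat.add_le_add_iff_left (ENat.natCast_ne_top _)).mp h3
    have h5 := M.min_el_le (fin y l) (fin x m₁) (inf x)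
    have h6 : ((9 * Fintype.card Q ^ 4 : ℕ) : ℕ∞) < M.el (fin y l) (inf x) := by
      refine lt_of_lt_of_le (lt_min ?_ ?_) h5
      · rw [M.el_comm]
        exact lt_of_lt_of_le (by exact_mod_cast he) h4
      · exact lt_of_le_of_lt (by exact_mod_cast hm₁') (M.lt_el_inf x m₁)
    have h7 := lt_of_lt_of_le h6 h1
    have h8 : 9 * Fintype.card Q ^ 4 < bnd (Fintype.card Q) (6 * Fintype.card Q ^ 2) := by
      exact_mod_cast h7
    omega
  have hrest := outs_ne_of_level (m := m₂) (k := k - μ) hx hr hβ hz hv₁ hm₂'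
    (by rw [Nat.cast_sub hμ, hm₂, ← hlev]; ring) hne
  have hne' : M.outs (fin x m) (wpow z μ ++ (wpow z (k - μ) ++ v₁ ++ v₂)) ≠
      M.outs (fin y n) (wpow z μ ++ (wpow z (k - μ) ++ v₁ ++ v₂)) := by
    apply M.outs_append_ne
    rw [run_wpow hx (m' := m₂) (by omega) (by omega) (by rw [hβ, hm₂]; ring),
      run_wpow hy (m' := l) (by omega) (by omega) (by rw [hγ, hl]; ring),
      M.outs_eq_of_lt (x := fin y l) (y := inf x) (by rw [htop]; exact ENat.natCast_lt_top _)]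
    exact hrest
  refine (M.el_le hne').trans (le_of_eq ?_)
  have : μ * z.length + (k - μ) * z.length = k * z.length := by
    rw [← Nat.add_mul, Nat.add_sub_cancel' hμ]
  simp only [List.length_append, length_wpow]
  congr 1
  omega

/-- Lowering both counters along the slope `a / b` shortens the witness accordingly. -/
lemma el_le_of_pump {m n k m₀ n₀ s a b : ℕ} (hx : M.un x z = x) (hy : M.un y z = y)
    (hr : M.un x v₁ = r) (hβ : M.eff x z = -β) (hβ₁ : 1 ≤ β) (hγ : M.eff y z = -γ)
    (hz : z.length ≤ Fintype.card Q ^ 2) (hv₁ : v₁.length ≤ 2 * Fintype.card Q ^ 2)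
    (hv₂ : v₂.length ≤ 8 * Fintype.card Q ^ 4)
    (hlev : (m : ℤ) - k * β + M.eff x v₁ = 5 * Fintype.card Q ^ 2)
    (hne : M.outs (fin r (5 * Fintype.card Q ^ 2)) v₂ ≠ M.outs (inf r) v₂)
    (hinf : M.el (inf x) (inf y) = ⊤) (ha : 1 ≤ a) (ha' : a ≤ Fintype.card Q ^ 2)
    (hb : 1 ≤ b) (hb' : b ≤ Fintype.card Q ^ 2)
    (hbelt : |(a : ℤ) * m - b * n| ≤ 46 * Fintype.card Q ^ 6)
    (hm : 200 * Fintype.card Q ^ 10 ≤ m) (hn : 200 * Fintype.card Q ^ 10 ≤ n)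
    (hm₀ : m₀ = m + s * β) (hn₀ : n ≤ n₀) (hs : (a : ℤ) * (s * β) = b * (n₀ - n))
    (hdvd : 0 < γ → γ ∣ (n₀ : ℤ) - n)
    (hw : M.outs (fin x m₀) (wpow z (s + k) ++ v₁ ++ v₂) ≠
      M.outs (fin y n₀) (wpow z (s + k) ++ v₁ ++ v₂))
    (hel : M.el (fin x m₀) (fin y n₀) = ((s + k) * z.length + v₁.length + v₂.length : ℕ)) :
    M.el (fin x m) (fin y n) ≤ (k * z.length + v₁.length + v₂.length : ℕ) := by
  have hK := card_pos_of_state x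
  have e1 := M.eff_bounds x v₁
  have ez := M.eff_bounds x z
  have ez' := M.eff_bounds y z
  rw [hβ] at ez
  rw [hγ] at ez'
  have hv₂' : v₂ ≠ [] := by
    rintro rfl
    exact hne rfl
  have p24 : Fintype.card Q ^ 2 ≤ Fintype.card Q ^ 4 := Nat.pow_le_pow_right hK (by norm_num)
  have p46 : Fintype.card Q ^ 4 ≤ Fintype.card Q ^ 6 := Nat.pow_le_pow_right hK (by norm_num)
  have p68 : Fintype.card Q ^ 6 ≤ Fintype.card Q ^ 8 := Nat.pow_le_pow_right hK (by norm_num)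
  have p8 : Fintype.card Q ^ 8 ≤ Fintype.card Q ^ 10 := Nat.pow_le_pow_right hK (by norm_num)
  have p2 : 0 < Fintype.card Q ^ 2 := by positivity
  have hm₂ : Fintype.card Q ^ 2 ≤ m := by omega
  have hn₂ : Fintype.card Q ^ 2 ≤ n := by omega
  zify at p24 p46 p68 p8 p2 hm hn ha hb ha' hb' hβ₁ hv₁ hv₂ hz
  obtain ⟨hb1, hb2⟩ := abs_le.mp hbelt
  have hγ' : γ ≤ (Fintype.card Q : ℤ) ^ 2 := by linarith
  have hβ' : (β : ℤ) ≤ (Fintype.card Q : ℤ) ^ 2 := by linarith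
  rcases lt_trichotomy ((a : ℤ) * β) (b * γ) with hlt | heq | hgt
  · have hγ₀ : 0 < γ := by
      by_contra! hc
      have h1 : (b : ℤ) * γ ≤ 0 := mul_nonpos_of_nonneg_of_nonpos (by positivity) hc
      have h2 : 0 ≤ (a : ℤ) * β := by positivity
      linarith
    obtain ⟨γ, rfl⟩ := Int.eq_ofNat_of_zero_le hγ₀.le
    obtain ⟨t, ht⟩ := hdvd hγ₀
    have ht₀ : 0 ≤ t := by
      by_contra! hc
      have := mul_neg_of_pos_of_neg hγ₀ hc
      omega
    obtain ⟨t, rfl⟩ := Int.eq_ofNat_of_zero_le ht₀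
    obtain ⟨μ, l, hl, hl5, hl6⟩ : ∃ μ l : ℕ, (l : ℤ) = n - μ * γ ∧
        5 * (Fintype.card Q : ℤ) ^ 2 ≤ l ∧ (l : ℤ) ≤ 6 * (Fintype.card Q : ℤ) ^ 2 := by
      obtain ⟨n', hn'⟩ : ∃ n' : ℕ, (n' : ℤ) = n - 5 * (Fintype.card Q : ℤ) ^ 2 :=
        ⟨((n : ℤ) - 5 * (Fintype.card Q : ℤ) ^ 2).toNat, by omega⟩
      have h1 := Nat.mod_add_div n' γ
      have h2 := Nat.mod_lt n' (show γ > 0 by omega)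
      zify at h1 h2
      refine ⟨n' / γ, n' % γ + 5 * Fintype.card Q ^ 2, ?_, ?_, ?_⟩
      · push_cast
        linarith
      · push_cast
        have : (0 : ℤ) ≤ n' % γ := Int.emod_nonneg _ hγ₀.ne'
        linarith
      · push_cast
        linarith
    have hμ : 194 * (Fintype.card Q : ℤ) ^ 8 ≤ μ := by
      refine le_of_mul_le_mul_of_le (c := γ) (D := (Fintype.card Q : ℤ) ^ 2) (by omega) hγ'
        (by positivity) ?_
      have : (Fintype.card Q : ℤ) ^ 2 * (194 * (Fintype.card Q : ℤ) ^ 8) =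
        194 * (Fintype.card Q : ℤ) ^ 10 := by ring
      linarith
    have hμγ : (a : ℤ) * (μ * β) ≤ b * (μ * γ) - μ := by
      have : (μ : ℤ) * (a * β) ≤ μ * (b * γ - 1) :=
        mul_le_mul_of_nonneg_left (by linarith) (by positivity)
      linarith
    have hbl : 0 ≤ (b : ℤ) * l := by positivity
    have hbl' : (b : ℤ) * l = b * n - b * (μ * γ) := by rw [hl]; ring
    have key : 148 * (Fintype.card Q : ℤ) ^ 6 ≤ m - μ * β := by
      refine le_of_mul_le_mul_of_le (c := a) (D := (Fintype.card Q : ℤ) ^ 2) (by omega) ha'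
        (by positivity) ?_
      have : (Fintype.card Q : ℤ) ^ 2 * (148 * (Fintype.card Q : ℤ) ^ 6) =
        148 * (Fintype.card Q : ℤ) ^ 8 := by ring
      have : (a : ℤ) * (m - μ * β) = a * m - a * (μ * β) := by ring
      linarith
    have hst : (0 : ℤ) ≤ s * β - t * β := by
      have h1 : (a : ℤ) * (s * β - t * β) = t * (b * γ - a * β) := by
        rw [mul_sub, hs, ht]
        ring
      have h2 : 0 ≤ (t : ℤ) * (b * γ - a * β) := mul_nonneg (by positivity) (by linarith)
      rw [← h1] at h2
      exact nonneg_of_mul_nonneg_right h2 (by linarith)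
    obtain ⟨m₂, hm₂'⟩ : ∃ m₂ : ℕ, (m₂ : ℤ) = m - μ * β :=
      ⟨((m : ℤ) - μ * β).toNat, by omega⟩
    obtain ⟨m₁, hm₁'⟩ : ∃ m₁ : ℕ, (m₁ : ℤ) = m₀ - (μ + t : ℕ) * β := by
      refine ⟨((m₀ : ℤ) - (μ + t : ℕ) * β).toNat, Int.toNat_of_nonneg ?_⟩
      rw [hm₀]
      push_cast
      linarith
    have hm₁₂ : (m₂ : ℤ) ≤ m₁ := by
      rw [hm₁', hm₂', hm₀]
      push_cast
      linarith
    have hμk : μ ≤ k := by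
      by_contra! hc
      have : (k : ℤ) * β ≤ μ * β := mul_le_mul_of_nonneg_right (by omega) (by positivity)
      linarith
    have hμ₀ : μ + t ≤ s + k := by
      by_contra! hc
      have h1 : ((s + k : ℕ) : ℤ) * β ≤ (μ + t : ℕ) * β :=
        mul_le_mul_of_nonneg_right (by exact_mod_cast hc.le) (by positivity)
      push_cast at h1
      linarith
    refine el_le_of_fast (m₀ := m₀) (n₀ := n₀) (μ := μ) (μ₀ := μ + t) (l := l) (m₁ := m₁)
      (m₂ := m₂) (e := (s + k - (μ + t)) * z.length + v₁.length + v₂.length)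
      hx hy hr hβ hγ (by exact_mod_cast hz) (by exact_mod_cast hv₁) hm₂ hn₂
      (by rw [hm₀]; exact hm₂.trans (Nat.le_add_right _ _)) (hn₂.trans hn₀) hlev hne hl ?_
      (by exact_mod_cast hl5) (by exact_mod_cast hl6) hm₁' hm₂' hμk ?_ ?_ ?_ ?_
    · push_cast
      linarith
    · zify
      linarith
    · zify
      linarith
    · have h1 : ((s + k - (μ + t) : ℕ) : ℤ) * β ≤ (s + k - (μ + t) : ℕ) * z.length :=
        mul_le_mul_of_nonneg_left (by linarith) (by positivity)
      zify
      have h2 : ((s + k - (μ + t) : ℕ) : ℤ) * β = m₁ - (m - k * β) := by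
        rw [Nat.cast_sub hμ₀, hm₁', hm₀]
        push_cast
        ring
      have h3 : (0 : ℤ) ≤ v₁.length := by positivity
      have h4 : (0 : ℤ) ≤ v₂.length := by positivity
      linarith
    · rw [hel]
      have : (μ + t) * z.length + (s + k - (μ + t)) * z.length = (s + k) * z.length := by
        rw [← Nat.add_mul, Nat.add_sub_cancel' hμ₀]
      exact_mod_cast (by omega)
  · refine el_le_of_equal_rate (m₀ := m₀) (n₀ := n₀) (s := s) hx hy hβ hγ hv₂'
      (by omega) (by omega) (by omega) (by omega) (by rw [hm₀]; push_cast; ring) ?_ hw hel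
    have : (b : ℤ) * (n₀ - n) = b * (s * γ) := by
      rw [← hs]
      linear_combination (s : ℤ) * heq
    have := mul_left_cancel₀ (by omega) this
    linarith
  · have hk : 193 * (Fintype.card Q : ℤ) ^ 8 ≤ k := by
      refine le_of_mul_le_mul_of_le (c := β) (D := (Fintype.card Q : ℤ) ^ 2) hβ₁ hβ'
        (by positivity) ?_
      have : (Fintype.card Q : ℤ) ^ 2 * (193 * (Fintype.card Q : ℤ) ^ 8) =
        193 * (Fintype.card Q : ℤ) ^ 10 := by ring
      linarith
    have hkγ : (b : ℤ) * (k * γ) ≤ a * (k * β) - k := by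
      have : (k : ℤ) * (b * γ) ≤ k * (a * β - 1) :=
        mul_le_mul_of_nonneg_left (by linarith) (by positivity)
      linarith
    have key : 147 * (Fintype.card Q : ℤ) ^ 6 ≤ n - k * γ := by
      refine le_of_mul_le_mul_of_le (c := b) (D := (Fintype.card Q : ℤ) ^ 2) hb hb'
        (by positivity) ?_
      have h1 : (Fintype.card Q : ℤ) ^ 2 * (147 * (Fintype.card Q : ℤ) ^ 6) =
        147 * (Fintype.card Q : ℤ) ^ 8 := by ring
      have h2 : (b : ℤ) * (n - k * γ) = b * n - b * (k * γ) := by ring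
      have h3 : 0 ≤ (a : ℤ) * (m - k * β) := mul_nonneg (by positivity) (by linarith)
      linarith
    obtain ⟨n₂, hn₂'⟩ : ∃ n₂ : ℕ, (n₂ : ℤ) = n - k * γ :=
      ⟨((n : ℤ) - k * γ).toNat, by omega⟩
    refine el_le_of_slow hx hy hr hβ hγ (by exact_mod_cast hz) (by exact_mod_cast hv₁) hm₂ hn₂
      hlev hne hinf hn₂' ?_
    zify
    linarith

end Pump

variable (M)

lemma el_fin_fin_eq_inf {p q : Q} {m n : ℕ} (hm : Fintype.card Q ^ 2 ≤ m)
    (hn : Fintype.card Q ^ 2 ≤ n) (h : M.el (inf p) (inf q) ≠ ⊤) :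
    M.el (fin p m) (fin q n) = M.el (inf p) (inf q) := by
  have h1 := M.el_inf_inf_le h
  have hm' : ((Fintype.card Q ^ 2 : ℕ) : ℕ∞) < M.el (fin p m) (inf p) :=
    lt_of_le_of_lt (by exact_mod_cast hm) (M.lt_el_inf p m)
  have hn' : ((Fintype.card Q ^ 2 : ℕ) : ℕ∞) < M.el (fin q n) (inf q) :=
    lt_of_le_of_lt (by exact_mod_cast hn) (M.lt_el_inf q n)
  have h2 : M.el (fin p m) (inf q) = M.el (inf p) (inf q) := by
    rw [M.el_comm, M.el_comm (inf p)]
    apply M.el_eq_of_lt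
    rw [M.el_comm, M.el_comm (inf p) (fin p m)]
    exact lt_of_le_of_lt h1 hm'
  rw [← h2]
  apply M.el_eq_of_lt
  rw [h2, M.el_comm (inf q)]
  exact lt_of_le_of_lt h1 hn'

variable {M}

/-- The loop of a descent can be replaced by a power that is also a loop at a state reached from
a given second state. -/
lemma Descent.exists_common {p : Q} {m : ℕ} (δ : M.Descent p m) (hk : Fintype.card Q ≤ δ.k)
    (q : Q) : ∃ (y : Q) (z v₀ v₁ : List Γ) (β k : ℕ), M.un p v₀ = δ.x ∧ M.un q v₀ = y ∧
      M.un δ.x z = δ.x ∧ M.un y z = y ∧ M.un δ.x v₁ = δ.r ∧ M.eff δ.x z = -β ∧ 1 ≤ β ∧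
      z.length ≤ Fintype.card Q ^ 2 ∧ v₀.length ≤ 2 * Fintype.card Q ^ 2 ∧
      v₁.length ≤ 2 * Fintype.card Q ^ 2 ∧
      (m : ℤ) + M.eff p v₀ - k * β + M.eff δ.x v₁ = 5 * Fintype.card Q ^ 2 ∧
      v₀.length + k * z.length + v₁.length + δ.v₂.length = δ.len := by
  obtain ⟨i, hi, j, hj, hij, he⟩ := Finset.exists_ne_map_eq_of_card_lt_of_maps_to
    (s := Finset.range (Fintype.card Q + 1)) (t := Finset.univ)
    (f := fun i => M.un q (δ.v₀ ++ wpow δ.z i)) (by simp) (fun _ _ => Finset.mem_univ _)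
  wlog hlt : i < j generalizing i j
  · exact this j hj i hi hij.symm he.symm (by omega)
  have hjK := Finset.mem_range.mp hj
  obtain ⟨ε, rfl⟩ := Nat.exists_eq_add_of_lt hlt
  have hdm := Nat.mod_add_div (δ.k - i) (ε + 1)
  have hml := Nat.mod_lt (δ.k - i) (Nat.succ_pos ε)
  generalize (δ.k - i) % (ε + 1) = ρ at hdm hml
  generalize (δ.k - i) / (ε + 1) = k at hdm
  have hk' : δ.k = i + k * (ε + 1) + ρ := by
    rw [mul_comm k]
    omega
  have hi' : M.un p (δ.v₀ ++ wpow δ.z i) = δ.x := by rw [un_append, δ.un_v₀, un_wpow δ.un_z]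
  have hlen : ∀ c, c ≤ Fintype.card Q → c * δ.z.length ≤ Fintype.card Q ^ 2 := by
    intro c hc
    rw [pow_two]
    exact Nat.mul_le_mul hc δ.length_z
  refine ⟨M.un q (δ.v₀ ++ wpow δ.z i), wpow δ.z (ε + 1), δ.v₀ ++ wpow δ.z i,
    wpow δ.z ρ ++ δ.v₁, (ε + 1) * δ.β, k, hi', rfl, un_wpow δ.un_z _, ?_, ?_, ?_, ?_, ?_, ?_, ?_,
    ?_, ?_⟩
  · rw [← un_append, List.append_assoc, ← wpow_add, ← add_assoc]
    exact he.symm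
  · rw [un_append, un_wpow δ.un_z, δ.un_v₁]
  · rw [eff_wpow δ.un_z, δ.eff_z]
    push_cast
    ring
  · exact Nat.mul_pos (Nat.succ_pos _) δ.one_le_β
  · rw [length_wpow]
    exact hlen _ (by omega)
  · have := hlen i (by omega)
    have := δ.length_v₀
    simp only [List.length_append, length_wpow]
    omega
  · have := hlen ρ (by omega)
    have := δ.length_v₁
    simp only [List.length_append, length_wpow]
    omega
  · rw [eff_append, eff_append, δ.un_v₀, un_wpow δ.un_z, eff_wpow δ.un_z, eff_wpow δ.un_z,
      δ.eff_z, ← δ.level, hk']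
    push_cast
    ring
  · simp only [List.length_append, length_wpow, Descent.len, hk']
    ring

variable (M)

/-- A pair of runs on a common word along which the distance decreases by one in each step. -/
structure MinRun (L : ℕ) where
  g : ℕ → Γ
  p : ℕ → Q
  q : ℕ → Q
  m : ℕ → ℕ
  n : ℕ → ℕ
  traj_m : M.Traj g p m
  traj_n : M.Traj g q n
  el_eq : ∀ i, i < L → M.el (fin (p i) (m i)) (fin (q i) (n i)) = (L - i : ℕ)

namespace MinRun

variable {M} {L : ℕ}

/-- The same pair of runs in the opposite order. -/
def symm (R : M.MinRun L) : M.MinRun L where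
  g := R.g
  p := R.q
  q := R.p
  m := R.n
  n := R.m
  traj_m := R.traj_n
  traj_n := R.traj_m
  el_eq i hi := by rw [M.el_comm, R.el_eq i hi]

/-- Positions at which both counters are large and both configurations have the same distance to
equivalent states of the finite machine. -/
structure Good (R : M.MinRun L) (i : ℕ) : Prop where
  lt : i < L
  high_m : 200 * Fintype.card Q ^ 8 < R.m i
  high_n : 200 * Fintype.card Q ^ 8 < R.n i
  equiv : M.el (inf (R.p i)) (inf (R.q i)) = ⊤
  el_eq_el : M.el (fin (R.p i) (R.m i)) (inf (R.p i)) = M.el (fin (R.q i) (R.n i)) (inf (R.q i))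

variable {R : M.MinRun L} {i : ℕ}

lemma Good.symm (h : R.Good i) : R.symm.Good i :=
  ⟨h.lt, h.high_n, h.high_m, by rw [M.el_comm]; exact h.equiv, h.el_eq_el.symm⟩

lemma Good.el_le (h : R.Good i) : M.el (fin (R.p i) (R.m i)) (inf (R.p i)) ≤ (L - i : ℕ) := by
  rw [← R.el_eq i h.lt]
  exact M.le_el_fin_fin h.equiv h.el_eq_el

lemma Good.el_ne_top (h : R.Good i) : M.el (fin (R.p i) (R.m i)) (inf (R.p i)) ≠ ⊤ :=
  ne_top_of_le_ne_top (ENat.natCast_ne_top _) h.el_le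

lemma Good.lt_sub (h : R.Good i) : R.m i < L - i := by
  have := (M.lt_el_inf (R.p i) (R.m i)).trans_le h.el_le
  exact_mod_cast this

lemma Good.nonempty_descent (h : R.Good i) : Nonempty (M.Descent (R.p i) (R.m i)) := by
  have hK := card_pos_of_state (R.p i)
  have p28 : Fintype.card Q ^ 2 ≤ Fintype.card Q ^ 8 := Nat.pow_le_pow_right hK (by norm_num)
  have := h.high_m
  exact exists_descent (by omega) h.el_ne_top

lemma Good.n_le (h : R.Good i) :
    R.n i ≤ Fintype.card Q * R.m i + 20 * Fintype.card Q ^ 4 := by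
  obtain ⟨δ⟩ := h.nonempty_descent
  have h1 := M.lt_el_inf (R.q i) (R.n i)
  rw [← h.el_eq_el, δ.el_eq_len] at h1
  have h2 : R.n i < δ.len := by exact_mod_cast h1
  have := δ.len_le
  omega

/-- The counters of a good position have almost a fixed ratio. -/
lemma Good.exists_slope (h : R.Good i) : ∃ a b : ℕ, a.Coprime b ∧ 1 ≤ a ∧ a ≤ Fintype.card Q ^ 2 ∧
    1 ≤ b ∧ b ≤ Fintype.card Q ^ 2 ∧
    |(a : ℤ) * R.m i - b * R.n i| ≤ 40 * (Fintype.card Q : ℤ) ^ 6 := by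
  obtain ⟨δ₁⟩ := h.nonempty_descent
  obtain ⟨δ₂⟩ := h.symm.nonempty_descent
  have hlen : δ₁.len = δ₂.len := by
    have h1 := δ₁.el_eq_len
    have h2 := δ₂.el_eq_len
    rw [h.el_eq_el] at h1
    exact_mod_cast h1.symm.trans h2
  have b1 := δ₁.belt
  have b2 := δ₂.belt
  have hβ1 := δ₁.one_le_β
  have hβ2 := δ₂.one_le_β
  have hz1 := δ₁.length_z
  have hz2 := δ₂.length_z
  have hl1 := δ₁.β_le_length
  have hl2 := δ₂.β_le_length
  rw [hlen] at b1
  change |(δ₂.β : ℤ) * δ₂.len - δ₂.z.length * R.n i| ≤ _ at b2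
  generalize δ₂.len = I at *
  generalize δ₁.z.length = α₁ at *
  generalize δ₂.z.length = α₂ at *
  generalize δ₁.β = β₁ at *
  generalize δ₂.β = β₂ at *
  set K := Fintype.card Q with hKdef
  have hA : β₂ * α₁ ≤ K ^ 2 := by rw [pow_two]; exact Nat.mul_le_mul (by omega) hz1
  have hB : β₁ * α₂ ≤ K ^ 2 := by rw [pow_two]; exact Nat.mul_le_mul (by omega) hz2
  have hA0 : 0 < β₂ * α₁ := Nat.mul_pos (by omega) (by omega)
  have hB0 : 0 < β₁ * α₂ := Nat.mul_pos (by omega) (by omega)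
  have hAB : |((β₂ * α₁ : ℕ) : ℤ) * R.m i - (β₁ * α₂ : ℕ) * R.n i| ≤ 40 * (K : ℤ) ^ 6 := by
    have e : ((β₂ * α₁ : ℕ) : ℤ) * R.m i - (β₁ * α₂ : ℕ) * R.n i =
        β₁ * ((β₂ : ℤ) * I - α₂ * R.n i) - β₂ * ((β₁ : ℤ) * I - α₁ * R.m i) := by
      push_cast
      ring
    rw [e]
    refine (abs_sub _ _).trans ?_
    rw [abs_mul, abs_mul, abs_of_nonneg (by positivity : (0 : ℤ) ≤ β₁),
      abs_of_nonneg (by positivity : (0 : ℤ) ≤ β₂)]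
    have c1 := mul_le_mul_of_nonneg_left b2 (by positivity : (0 : ℤ) ≤ β₁)
    have c2 := mul_le_mul_of_nonneg_left b1 (by positivity : (0 : ℤ) ≤ β₂)
    have hββ : (β₁ : ℤ) * β₂ ≤ (K : ℤ) ^ 2 := by
      rw [pow_two]
      exact_mod_cast Nat.mul_le_mul (hl1.trans hz1) (hl2.trans hz2)
    have c3 := mul_le_mul_of_nonneg_right hββ (by positivity : (0 : ℤ) ≤ 40 * (K : ℤ) ^ 4)
    have e3 : (K : ℤ) ^ 2 * (40 * (K : ℤ) ^ 4) = 40 * (K : ℤ) ^ 6 := by ring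
    linarith
  generalize β₂ * α₁ = A at *
  generalize β₁ * α₂ = B at *
  obtain ⟨d, a, b, hd, hcop, rfl, rfl⟩ := Nat.exists_coprime' (m := A) (n := B)
    (Nat.gcd_pos_of_pos_left _ hA0)
  have ha : 0 < a := Nat.pos_of_mul_pos_right hA0
  have hb : 0 < b := Nat.pos_of_mul_pos_right hB0
  refine ⟨a, b, hcop, ha, (Nat.le_mul_of_pos_right _ hd).trans hA, hb,
    (Nat.le_mul_of_pos_right _ hd).trans hB, ?_⟩
  have e : (((a * d : ℕ) : ℤ) * R.m i - (b * d : ℕ) * R.n i) = (a * R.m i - b * R.n i) * d := by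
    push_cast
    ring
  rw [e, abs_mul] at hAB
  refine le_trans (le_mul_of_one_le_right (abs_nonneg _) ?_) hAB
  rw [abs_of_nonneg (by positivity)]
  exact_mod_cast hd

/-- Coprime slopes of two neighbouring points agree. -/
lemma slope_unique {K a b a' b' : ℕ} {m n m' n' : ℤ} (hK : 0 < K) (h : a.Coprime b)
    (h' : a'.Coprime b') (ha : a ≤ K ^ 2) (ha' : a' ≤ K ^ 2) (hb' : b' ≤ K ^ 2)
    (hmn : |a * m - b * n| ≤ 40 * (K : ℤ) ^ 6) (hmn' : |a' * m' - b' * n'| ≤ 40 * (K : ℤ) ^ 6)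
    (hm : |m - m'| ≤ 1) (hn : |n - n'| ≤ 1) (hlarge : 200 * (K : ℤ) ^ 8 < n) : a = a' ∧ b = b' := by
  have hstep : |a' * m - b' * n| ≤ 42 * (K : ℤ) ^ 6 := by
    have e : a' * m - b' * n = (a' * m' - b' * n') + (a' * (m - m') - b' * (n - n')) := by ring
    have c1 : |(a' : ℤ) * (m - m')| ≤ (K : ℤ) ^ 2 := by
      rw [abs_mul, abs_of_nonneg (by positivity)]
      calc (a' : ℤ) * |m - m'| ≤ (K : ℤ) ^ 2 * 1 :=
            mul_le_mul (by exact_mod_cast ha') hm (abs_nonneg _) (by positivity)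
        _ = _ := mul_one _
    have c2 : |(b' : ℤ) * (n - n')| ≤ (K : ℤ) ^ 2 := by
      rw [abs_mul, abs_of_nonneg (by positivity)]
      calc (b' : ℤ) * |n - n'| ≤ (K : ℤ) ^ 2 * 1 :=
            mul_le_mul (by exact_mod_cast hb') hn (abs_nonneg _) (by positivity)
        _ = _ := mul_one _
    have p26 : (K : ℤ) ^ 2 ≤ (K : ℤ) ^ 6 := by
      exact_mod_cast Nat.pow_le_pow_right hK (by norm_num)
    rw [e]
    have := (abs_add_le (a' * m' - b' * n') (a' * (m - m') - b' * (n - n'))).trans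
      (add_le_add hmn' (abs_sub _ _))
    linarith
  have hdet : ((a : ℤ) * b' - a' * b) * n = a' * (a * m - b * n) - a * (a' * m - b' * n) := by ring
  have hz : (a : ℤ) * b' - a' * b = 0 := by
    by_contra hne
    have h1 : 1 ≤ |(a : ℤ) * b' - a' * b| := Int.one_le_abs hne
    have p8 : (0 : ℤ) ≤ (K : ℤ) ^ 8 := by positivity
    have h2 : n ≤ |((a : ℤ) * b' - a' * b) * n| := by
      rw [abs_mul, abs_of_nonneg (by linarith : 0 ≤ n)]
      exact le_mul_of_one_le_left (by linarith) h1
    rw [hdet] at h2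
    have h3 := h2.trans (abs_sub _ _)
    rw [abs_mul, abs_mul, abs_of_nonneg (by positivity : (0 : ℤ) ≤ a),
      abs_of_nonneg (by positivity : (0 : ℤ) ≤ a')] at h3
    have c1 : (a' : ℤ) * |a * m - b * n| ≤ (K : ℤ) ^ 2 * (40 * (K : ℤ) ^ 6) :=
      mul_le_mul (by exact_mod_cast ha') hmn (abs_nonneg _) (by positivity)
    have c2 : (a : ℤ) * |a' * m - b' * n| ≤ (K : ℤ) ^ 2 * (42 * (K : ℤ) ^ 6) :=
      mul_le_mul (by exact_mod_cast ha) hstep (abs_nonneg _) (by positivity)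
    have e1 : (K : ℤ) ^ 2 * (40 * (K : ℤ) ^ 6) = 40 * (K : ℤ) ^ 8 := by ring
    have e2 : (K : ℤ) ^ 2 * (42 * (K : ℤ) ^ 6) = 42 * (K : ℤ) ^ 8 := by ring
    linarith
  have hN : a * b' = a' * b := by
    have : (a : ℤ) * b' = a' * b := by linarith
    exact_mod_cast this
  constructor
  · exact Nat.dvd_antisymm (h.dvd_of_dvd_mul_right ⟨b', hN.symm⟩)
      (h'.dvd_of_dvd_mul_right ⟨b, hN⟩)
  · exact Nat.dvd_antisymm (h.symm.dvd_of_dvd_mul_left ⟨a', by rw [hN, mul_comm]⟩)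
      (h'.symm.dvd_of_dvd_mul_left ⟨a, by rw [← hN, mul_comm]⟩)

variable {s e a b : ℕ}

/-- A stretch of a pair of runs on which both counters are large and proportional. -/
structure Stretch (R : M.MinRun L) (s e a b : ℕ) : Prop where
  le : s ≤ e
  lt : e < L
  one_le_a : 1 ≤ a
  a_le : a ≤ Fintype.card Q ^ 2
  one_le_b : 1 ≤ b
  b_le : b ≤ Fintype.card Q ^ 2
  high_m : ∀ k, s ≤ k → k ≤ e → 200 * Fintype.card Q ^ 8 ≤ R.m k
  high_n : ∀ k, s ≤ k → k ≤ e → 200 * Fintype.card Q ^ 8 ≤ R.n k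
  belt : ∀ k, s ≤ k → k ≤ e →
    |(a : ℤ) * R.m k - b * R.n k| ≤ 42 * (Fintype.card Q : ℤ) ^ 6
  m_le : ∀ k, s ≤ k → k ≤ e → R.m k ≤ Fintype.card Q * R.n k + 23 * Fintype.card Q ^ 4
  n_le : ∀ k, s ≤ k → k ≤ e → R.n k ≤ Fintype.card Q * R.m k + 23 * Fintype.card Q ^ 4
  m_start : R.m s ≤ 300 * Fintype.card Q ^ 9
  n_start : R.n s ≤ 300 * Fintype.card Q ^ 9

lemma Stretch.symm (h : R.Stretch s e a b) : R.symm.Stretch s e b a where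
  le := h.le
  lt := h.lt
  one_le_a := h.one_le_b
  a_le := h.b_le
  one_le_b := h.one_le_a
  b_le := h.a_le
  high_m := h.high_n
  high_n := h.high_m
  belt k h1 h2 := by rw [abs_sub_comm]; exact h.belt k h1 h2
  m_le := h.n_le
  n_le := h.m_le
  m_start := h.n_start
  n_start := h.m_start

/-- Good positions following each other have the same slope. -/
lemma exists_common_slope {s l : ℕ} (h : ∀ k, s ≤ k → k ≤ s + l → R.Good k) :
    ∃ a b : ℕ, a.Coprime b ∧ 1 ≤ a ∧ a ≤ Fintype.card Q ^ 2 ∧ 1 ≤ b ∧ b ≤ Fintype.card Q ^ 2 ∧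
      ∀ k, s ≤ k → k ≤ s + l → |(a : ℤ) * R.m k - b * R.n k| ≤ 40 * (Fintype.card Q : ℤ) ^ 6 := by
  induction l with
  | zero =>
    obtain ⟨a, b, h1, h2, h3, h4, h5, h6⟩ := (h s le_rfl le_rfl).exists_slope
    refine ⟨a, b, h1, h2, h3, h4, h5, fun k hk hk' => ?_⟩
    obtain rfl : k = s := by omega
    exact h6
  | succ l ih =>
    obtain ⟨a, b, h1, h2, h3, h4, h5, h6⟩ := ih fun k hk hk' => h k hk (by omega)
    refine ⟨a, b, h1, h2, h3, h4, h5, fun k hk hk' => ?_⟩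
    rcases Nat.lt_or_ge k (s + l + 1) with hlt | hge
    · exact h6 k hk (by omega)
    obtain rfl : k = s + l + 1 := by omega
    have hg := h (s + l + 1) hk hk'
    obtain ⟨a', b', h1', -, h3', -, h5', h6'⟩ := hg.exists_slope
    have sm := R.traj_m.slow (s + l)
    have sn := R.traj_n.slow (s + l)
    obtain ⟨rfl, rfl⟩ := slope_unique (card_pos_of_state (R.p s)) h1 h1' h3 h3' h5'
      (h6 (s + l) (by omega) le_rfl) h6' (by rw [abs_le]; omega) (by rw [abs_le]; omega)
      (by exact_mod_cast (h (s + l) (by omega) (by omega)).high_n)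
    exact h6'

lemma exists_stretch (hse : s + 1 < e) (h : ∀ k, s < k → k < e → R.Good k)
    (hm : R.m s ≤ 300 * Fintype.card Q ^ 9) (hn : R.n s ≤ 300 * Fintype.card Q ^ 9) :
    ∃ a b, R.Stretch s e a b := by
  have hK := card_pos_of_state (R.p s)
  obtain ⟨a, b, -, ha, ha', hb, hb', hbelt⟩ := exists_common_slope (R := R) (s := s + 1)
    (l := e - s - 2) fun k hk hk' => h k (by omega) (by omega)
  have near : ∀ k, s ≤ k → k ≤ e → ∃ j, s < j ∧ j < e ∧ R.m k ≤ R.m j + 1 ∧ R.m j ≤ R.m k + 1 ∧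
      R.n k ≤ R.n j + 1 ∧ R.n j ≤ R.n k + 1 := by
    intro k hk hk'
    rcases hk.eq_or_lt with rfl | hk
    · have sm := R.traj_m.slow s
      have sn := R.traj_n.slow s
      exact ⟨s + 1, by omega⟩
    rcases hk'.eq_or_lt with rfl | hk'
    · have sm := R.traj_m.slow (k - 1)
      have sn := R.traj_n.slow (k - 1)
      rw [Nat.sub_add_cancel (by omega)] at sm sn
      exact ⟨k - 1, by omega⟩
    · exact ⟨k, by omega⟩
  have p1 : Fintype.card Q ≤ Fintype.card Q ^ 4 := Nat.le_self_pow (by norm_num) _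
  have p14 : 0 < Fintype.card Q ^ 4 := by positivity
  have p18 : 0 < Fintype.card Q ^ 8 := by positivity
  have p26 : Fintype.card Q ^ 2 ≤ Fintype.card Q ^ 6 := Nat.pow_le_pow_right hK (by norm_num)
  refine ⟨a, b, by omega, ?_, ha, ha', hb, hb', ?_, ?_, ?_, ?_, ?_, hm, hn⟩
  · have hg := h (e - 1) (by omega) (by omega)
    have h1 := hg.lt_sub
    have h2 := hg.high_m
    omega
  · intro k hk hk'
    obtain ⟨j, h1, h2, h3⟩ := near k hk hk'
    have := (h j h1 h2).high_m
    omega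
  · intro k hk hk'
    obtain ⟨j, h1, h2, h3⟩ := near k hk hk'
    have := (h j h1 h2).high_n
    omega
  · intro k hk hk'
    obtain ⟨j, h1, h2, h3, h4, h5, h6⟩ := near k hk hk'
    obtain ⟨c1, c2⟩ := abs_le.mp (hbelt j (by omega) (by omega))
    zify at h3 h4 h5 h6 ha' hb' p26
    have d1 : (a : ℤ) * R.m k ≤ a * (R.m j + 1) := mul_le_mul_of_nonneg_left h3 (by positivity)
    have d2 : (a : ℤ) * R.m j ≤ a * (R.m k + 1) := mul_le_mul_of_nonneg_left h4 (by positivity)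
    have d3 : (b : ℤ) * R.n k ≤ b * (R.n j + 1) := mul_le_mul_of_nonneg_left h5 (by positivity)
    have d4 : (b : ℤ) * R.n j ≤ b * (R.n k + 1) := mul_le_mul_of_nonneg_left h6 (by positivity)
    rw [abs_le]
    constructor <;> linarith
  · intro k hk hk'
    obtain ⟨j, h1, h2, h3, h4, h5, h6⟩ := near k hk hk'
    have h7 := (h j h1 h2).symm.n_le
    have h8 : Fintype.card Q * R.n j ≤ Fintype.card Q * (R.n k + 1) := Nat.mul_le_mul_left _ h6
    rw [mul_add] at h8
    change R.m j ≤ Fintype.card Q * R.n j + _ at h7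
    omega
  · intro k hk hk'
    obtain ⟨j, h1, h2, h3, h4, h5, h6⟩ := near k hk hk'
    have h7 := (h j h1 h2).n_le
    have h8 : Fintype.card Q * R.m j ≤ Fintype.card Q * (R.m k + 1) := Nat.mul_le_mul_left _ h4
    rw [mul_add] at h8
    omega

/-- A part of a stretch can be replayed from an earlier lower position of the same type. -/
lemma Stretch.replay (h : R.Stretch s e a b) {i j t : ℕ} (hi : s ≤ i) (hij : i < j) (hjt : j ≤ t)
    (ht : t ≤ e) (hm : R.m i < R.m j) (hp : R.p i = R.p j) (hq : R.q i = R.q j)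
    (ho : (a : ℤ) * R.m i - b * R.n i = a * R.m j - b * R.n j)
    (hmin : ∀ k, j ≤ k → k ≤ t → R.m j ≤ R.m k) :
    ∃ m' n' : ℕ, M.run (fin (R.p i) (R.m i)) (seg R.g j (t - j)) = fin (R.p t) m' ∧
      M.run (fin (R.q i) (R.n i)) (seg R.g j (t - j)) = fin (R.q t) n' ∧
      R.n i < R.n j ∧ (m' : ℤ) = R.m t - (R.m j - R.m i) ∧ (n' : ℤ) = R.n t - (R.n j - R.n i) ∧
      (a : ℤ) * (R.m j - R.m i) = b * (R.n j - R.n i) ∧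
      R.m i ≤ m' ∧ (R.n i : ℤ) - 84 * Fintype.card Q ^ 6 ≤ n' := by
  have hK := card_pos_of_state (R.p i)
  have p68 : Fintype.card Q ^ 6 ≤ Fintype.card Q ^ 8 := Nat.pow_le_pow_right hK (by norm_num)
  have p6 : 0 < Fintype.card Q ^ 6 := by positivity
  have ha := h.one_le_a
  have hb := h.one_le_b
  have hn : R.n i < R.n j := by
    zify at hm ha hb ⊢
    have h1 : 0 < (a : ℤ) * (R.m j - R.m i) := mul_pos (by linarith) (by linarith)
    have h2 : 0 < (b : ℤ) * (R.n j - R.n i) := by linarith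
    have := pos_of_mul_pos_right h2 (by linarith)
    linarith
  have hnmin : ∀ k, j ≤ k → k ≤ t → (R.n j : ℤ) - 84 * Fintype.card Q ^ 6 ≤ R.n k := by
    intro k hk hk'
    have h1 := abs_le.mp (h.belt k (by omega) (by omega))
    have h2 := abs_le.mp (h.belt j (by omega) (by omega))
    have h3 : (a : ℤ) * R.m j ≤ a * R.m k :=
      mul_le_mul_of_nonneg_left (by exact_mod_cast hmin k hk hk') (by positivity)
    by_contra! hc
    have h4 : (b : ℤ) * R.n k ≤ b * (R.n j - 84 * Fintype.card Q ^ 6 - 1) :=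
      mul_le_mul_of_nonneg_left (by linarith) (by positivity)
    have h5 : 1 * (84 * (Fintype.card Q : ℤ) ^ 6 + 1) ≤ b * (84 * (Fintype.card Q : ℤ) ^ 6 + 1) :=
      mul_le_mul_of_nonneg_right (by exact_mod_cast hb) (by positivity)
    linarith
  have hi1 := h.high_m i hi (by omega)
  have hi2 := h.high_n i hi (by omega)
  have r1 := R.traj_m.run_seg_sub j (t - j) (R.m j - R.m i) fun k hk hk' => by
    have := hmin k hk (by omega)
    omega
  have r2 := R.traj_n.run_seg_sub j (t - j) (R.n j - R.n i) fun k hk hk' => by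
    have := hnmin k hk (by omega)
    zify at p68 hi2 p6
    omega
  have ht1 := hmin t hjt le_rfl
  have ht2 := hnmin t hjt le_rfl
  rw [Nat.add_sub_cancel' hjt, Nat.sub_sub_self hm.le, ← hp] at r1
  rw [Nat.add_sub_cancel' hjt, Nat.sub_sub_self hn.le, ← hq] at r2
  zify at p68 hi2 p6
  refine ⟨_, _, r1, r2, hn, by omega, by omega, by linarith, by omega, by omega⟩

lemma card_types_le {K : ℕ} (hK : 0 < K) (hQ : Fintype.card Q = K) :
    ((Finset.univ : Finset Q) ×ˢ (Finset.univ : Finset Q) ×ˢ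
      Finset.Icc (-(42 * (K : ℤ) ^ 6)) (42 * (K : ℤ) ^ 6)).card ≤ 85 * K ^ 8 := by
  have h1 : (42 * (K : ℤ) ^ 6 + 1 - -(42 * (K : ℤ) ^ 6)).toNat = 84 * K ^ 6 + 1 := by
    have : ((K ^ 6 : ℕ) : ℤ) = (K : ℤ) ^ 6 := by push_cast; rfl
    omega
  have h2 : 0 < K ^ 6 := by positivity
  rw [Finset.card_product, Finset.card_product, Finset.card_univ, hQ, Int.card_Icc, h1]
  calc K * (K * (84 * K ^ 6 + 1)) ≤ K * (K * (85 * K ^ 6)) := by gcongr; omega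
    _ = 85 * K ^ 8 := by ring

/-- The counters on a stretch do not rise far above their values at its ends. -/
lemma Stretch.m_lt (h : R.Stretch s e a b) {l j : ℕ} (hl : 300 * Fintype.card Q ^ 9 ≤ l)
    (he : R.m e ≤ l) (hsj : s ≤ j) (hje : j ≤ e) : R.m j < l + 7225 * Fintype.card Q ^ 16 := by
  by_contra! hc
  have hK := card_pos_of_state (R.p s)
  have hs := h.m_start
  obtain ⟨i, j', c, d, h1, h2, h3, h4, h5, h6, h7, h8, h9, h10, h11, h12, -⟩ :=
    R.traj_m.slow.exists_up_down hsj hje (by omega) he hc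
      (fun k => (R.p k, R.q k, (a : ℤ) * R.m k - b * R.n k))
      (Finset.univ ×ˢ Finset.univ ×ˢ
        Finset.Icc (-(42 * (Fintype.card Q : ℤ) ^ 6)) (42 * (Fintype.card Q : ℤ) ^ 6))
      (fun k hk hk' => by
        have := abs_le.mp (h.belt k hk hk')
        simp only [Finset.mem_product, Finset.mem_univ, Finset.mem_Icc, true_and]
        exact this)
      (by
        refine (Nat.pow_le_pow_left (card_types_le hK rfl) 2).trans (le_of_eq ?_)
        ring)
  simp only [Prod.mk.injEq] at h10 h11
  obtain ⟨m', n', r1, r2, -, e1, e2, e3, -, -⟩ := h.replay h1 h2 h3 (by omega) h7 h10.1 h10.2.1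
    h10.2.2 h12
  have hb := h.one_le_b
  have hm' : m' = R.m d := by omega
  have hn' : n' = R.n d := by
    have e4 : (b : ℤ) * n' = b * R.n d := by
      rw [e2, mul_sub, ← e3]
      have := h11.2.2
      rw [h9, h8] at this
      linarith
    have := mul_left_cancel₀ (by omega) e4
    exact_mod_cast this
  have := M.el_le_run (fin (R.p i) (R.m i)) (fin (R.q i) (R.n i)) (seg R.g j' (c - j'))
  have hlt := h.lt
  rw [r1, r2, hm', hn', h11.1, h11.2.1, R.el_eq i (by omega), R.el_eq d (by omega), length_seg] at this
  have : L - i ≤ c - j' + (L - d) := by exact_mod_cast this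
  omega

/-- A stretch ending in a pair of inequivalent states ends low. -/
lemma Stretch.m_end_lt_of_inf (h : R.Stretch s e a b)
    (hinf : M.el (inf (R.p e)) (inf (R.q e)) ≠ ⊤) :
    R.m e < 300 * Fintype.card Q ^ 9 + 85 * Fintype.card Q ^ 8 := by
  by_contra! hc
  have hK := card_pos_of_state (R.p s)
  have p28 : Fintype.card Q ^ 2 ≤ Fintype.card Q ^ 8 := Nat.pow_le_pow_right hK (by norm_num)
  have p68 : Fintype.card Q ^ 6 ≤ Fintype.card Q ^ 8 := Nat.pow_le_pow_right hK (by norm_num)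
  obtain ⟨i, j, h1, h2, h3, h4, h5, h6, h7, -⟩ :=
    R.traj_m.slow.exists_up h.le h.m_start hc
      (fun k => (R.p k, R.q k, (a : ℤ) * R.m k - b * R.n k))
      (Finset.univ ×ˢ Finset.univ ×ˢ
        Finset.Icc (-(42 * (Fintype.card Q : ℤ) ^ 6)) (42 * (Fintype.card Q : ℤ) ^ 6))
      (fun k hk hk' => by
        have := abs_le.mp (h.belt k hk hk')
        simp only [Finset.mem_product, Finset.mem_univ, Finset.mem_Icc, true_and]
        exact this)
      (card_types_le hK rfl)
  simp only [Prod.mk.injEq] at h6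
  obtain ⟨m', n', r1, r2, -, -, -, -, e1, e2⟩ := h.replay h1 h2 h3 le_rfl h5 h6.1 h6.2.1 h6.2.2 h7
  have g1 := h.high_m i h1 (by omega)
  have g2 := h.high_n i h1 (by omega)
  have g3 := h.high_m e h.le le_rfl
  have g4 := h.high_n e h.le le_rfl
  have hn' : Fintype.card Q ^ 2 ≤ n' := by
    zify at *
    omega
  have := M.el_le_run (fin (R.p i) (R.m i)) (fin (R.q i) (R.n i)) (seg R.g j (e - j))
  have hlt := h.lt
  rw [r1, r2, M.el_fin_fin_eq_inf (by omega) hn' hinf,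
    ← M.el_fin_fin_eq_inf (m := R.m e) (n := R.n e) (by omega) (by omega) hinf,
    R.el_eq i (by omega), R.el_eq e hlt, length_seg] at this
  have : L - i ≤ e - j + (L - e) := by exact_mod_cast this
  omega

lemma card_types_mod_le {K c d : ℕ} (hK : 0 < K) (hQ : Fintype.card Q = K) (hc : c ≤ K ^ 2)
    (hd : d ≤ K ^ 2) :
    (((Finset.univ : Finset Q) ×ˢ (Finset.univ : Finset Q) ×ˢ
      Finset.Icc (-(42 * (K : ℤ) ^ 6)) (42 * (K : ℤ) ^ 6)) ×ˢ
      Finset.range c ×ˢ Finset.range d).card ≤ 85 * K ^ 12 := by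
  rw [Finset.card_product, Finset.card_product (Finset.range c), Finset.card_range,
    Finset.card_range]
  calc _ ≤ 85 * K ^ 8 * (K ^ 2 * K ^ 2) := Nat.mul_le_mul (card_types_le hK hQ) (Nat.mul_le_mul hc hd)
    _ = 85 * K ^ 12 := by ring

/-- A stretch ending in a position at which the first configuration is closer to its state than
the second one ends low. -/
lemma Stretch.m_end_lt_of_lt (h : R.Stretch s e a b)
    (hinf : M.el (inf (R.p e)) (inf (R.q e)) = ⊤)
    (hI : M.el (fin (R.p e) (R.m e)) (inf (R.p e)) < M.el (fin (R.q e) (R.n e)) (inf (R.q e))) :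
    R.m e < 400 * Fintype.card Q ^ 12 + 85 * Fintype.card Q ^ 12 := by
  by_contra! hc
  have hK := card_pos_of_state (R.p s)
  have p12 : Fintype.card Q ≤ Fintype.card Q ^ 2 := Nat.le_self_pow (by norm_num) _
  have p23 : Fintype.card Q ^ 2 ≤ Fintype.card Q ^ 3 := Nat.pow_le_pow_right hK (by norm_num)
  have p34 : Fintype.card Q ^ 3 ≤ Fintype.card Q ^ 4 := Nat.pow_le_pow_right hK (by norm_num)
  have p46 : Fintype.card Q ^ 4 ≤ Fintype.card Q ^ 6 := Nat.pow_le_pow_right hK (by norm_num)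
  have p68 : Fintype.card Q ^ 6 ≤ Fintype.card Q ^ 8 := Nat.pow_le_pow_right hK (by norm_num)
  have p89 : Fintype.card Q ^ 8 ≤ Fintype.card Q ^ 9 := Nat.pow_le_pow_right hK (by norm_num)
  have p910 : Fintype.card Q ^ 9 ≤ Fintype.card Q ^ 10 := Nat.pow_le_pow_right hK (by norm_num)
  have p1011 : Fintype.card Q ^ 10 ≤ Fintype.card Q ^ 11 := Nat.pow_le_pow_right hK (by norm_num)
  have p1112 : Fintype.card Q ^ 11 ≤ Fintype.card Q ^ 12 := Nat.pow_le_pow_right hK (by norm_num)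
  have p2 : 0 < Fintype.card Q ^ 2 := by positivity
  have hlt := h.lt
  obtain ⟨δ⟩ := exists_descent (p := R.p e) (m := R.m e) (by omega) hI.ne_top
  have hlen : δ.len = L - e := by
    have h1 := R.el_eq e hlt
    rw [M.el_fin_fin_of_lt hinf hI, δ.el_eq_len] at h1
    exact_mod_cast h1
  have hk : Fintype.card Q ≤ δ.k := by
    by_contra! hk
    have h1 := δ.level
    have h2 := M.eff_bounds (R.p e) δ.v₀
    have h3 := M.eff_bounds δ.x δ.v₁
    have h4 := δ.length_v₀
    have h5 := δ.length_v₁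
    have h6 : δ.k * δ.β ≤ Fintype.card Q * Fintype.card Q :=
      Nat.mul_le_mul hk.le (δ.β_le_length.trans δ.length_z)
    rw [← pow_two] at h6
    zify at *
    omega
  obtain ⟨y, z, v₀, v₁, β, k, hx, hy, hzx, hzy, hr, hβ, hβ₁, hz, hv₀, hv₁, hlev, htot⟩ :=
    δ.exists_common hk (R.q e)
  have hv₂ : δ.v₂.length ≤ 8 * Fintype.card Q ^ 4 := by
    have h1 := δ.length_v₂
    have h2 : bnd (Fintype.card Q) (5 * Fintype.card Q ^ 2) =
        Fintype.card Q ^ 2 + Fintype.card Q ^ 4 + 6 * Fintype.card Q ^ 3 := by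
      unfold bnd
      ring
    omega
  have ez := M.eff_bounds δ.x z
  have ez' := M.eff_bounds y z
  have e0 := M.eff_bounds (R.p e) v₀
  have e0' := M.eff_bounds (R.q e) v₀
  have e1 := M.eff_bounds δ.x v₁
  obtain ⟨γ, hγ⟩ : ∃ γ, M.eff y z = -γ := ⟨-M.eff y z, by ring⟩
  rw [hβ] at ez
  rw [hγ] at ez'
  obtain ⟨i, j, h1, h2, h3, h4, h5, h6, h7, -⟩ :=
    R.traj_m.slow.exists_up h.le (h.m_start.trans (by omega)) hc
      (fun k => ((R.p k, R.q k, (a : ℤ) * R.m k - b * R.n k), R.m k % β, R.n k % max γ.toNat 1))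
      ((Finset.univ ×ˢ Finset.univ ×ˢ
        Finset.Icc (-(42 * (Fintype.card Q : ℤ) ^ 6)) (42 * (Fintype.card Q : ℤ) ^ 6)) ×ˢ
        Finset.range β ×ˢ Finset.range (max γ.toNat 1))
      (fun k hk hk' => by
        have := abs_le.mp (h.belt k hk hk')
        simp only [Finset.mem_product, Finset.mem_univ, Finset.mem_Icc, true_and, Finset.mem_range]
        exact ⟨this, Nat.mod_lt _ (by omega), Nat.mod_lt _ (by omega)⟩)
      (card_types_mod_le hK rfl (by omega) (by omega))
  simp only [Prod.mk.injEq] at h6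
  obtain ⟨⟨hp, hq, ho⟩, hmod, hmod'⟩ := h6
  obtain ⟨m', n', r1, r2, hnij, em, en, eΔ, e4, e5⟩ := h.replay h1 h2 h3 le_rfl h5 hp hq ho h7
  obtain ⟨t, ht⟩ : β ∣ R.m j - R.m i := (Nat.modEq_iff_dvd' h5.le).mp hmod
  have ht' : (R.m j : ℤ) - R.m i = t * β := by
    rw [← Nat.cast_sub h5.le, ht]
    push_cast
    ring
  have hdvd : 0 < γ → γ ∣ (R.n j : ℤ) - R.n i := by
    intro hγ₀
    rw [max_eq_left (by omega)] at hmod'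
    have h8 := (Nat.modEq_iff_dvd' hnij.le).mp hmod'
    have h9 : ((γ.toNat : ℕ) : ℤ) ∣ ((R.n j - R.n i : ℕ) : ℤ) := by exact_mod_cast h8
    rwa [Int.toNat_of_nonneg hγ₀.le, Nat.cast_sub hnij.le] at h9
  have hni : 377 * Fintype.card Q ^ 11 ≤ R.n i := by
    have h8 := h.m_le i h1 (by omega)
    by_contra! hlt'
    have h9 : Fintype.card Q * R.n i < Fintype.card Q * (377 * Fintype.card Q ^ 11) :=
      Nat.mul_lt_mul_of_pos_left hlt' hK
    have h10 : Fintype.card Q * (377 * Fintype.card Q ^ 11) = 377 * Fintype.card Q ^ 12 := by ring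
    omega
  have hne : R.n i ≤ R.n e + 84 * Fintype.card Q ^ 6 := by
    zify at *
    omega
  obtain ⟨m₀, hm₀⟩ : ∃ m₀ : ℕ, (m₀ : ℤ) = R.m e + M.eff (R.p e) v₀ :=
    ⟨((R.m e : ℤ) + M.eff (R.p e) v₀).toNat, by zify at *; omega⟩
  obtain ⟨n₀, hn₀⟩ : ∃ n₀ : ℕ, (n₀ : ℤ) = R.n e + M.eff (R.q e) v₀ :=
    ⟨((R.n e : ℤ) + M.eff (R.q e) v₀).toNat, by zify at *; omega⟩
  obtain ⟨m₁, hm₁⟩ : ∃ m₁ : ℕ, (m₁ : ℤ) = m' + M.eff (R.p e) v₀ :=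
    ⟨((m' : ℤ) + M.eff (R.p e) v₀).toNat, by zify at *; omega⟩
  obtain ⟨n₁, hn₁⟩ : ∃ n₁ : ℕ, (n₁ : ℤ) = n' + M.eff (R.q e) v₀ :=
    ⟨((n' : ℤ) + M.eff (R.q e) v₀).toNat, by zify at *; omega⟩
  have htk : t ≤ k := by
    by_contra! hc'
    have h8 : (k : ℤ) * β ≤ t * β := mul_le_mul_of_nonneg_right (by omega) (by positivity)
    zify at *
    omega
  obtain ⟨k', rfl⟩ := Nat.exists_eq_add_of_le htk
  have hrun : M.run (fin (R.p e) (R.m e)) v₀ = fin δ.x m₀ := by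
    rw [M.run_fin (by omega) hm₀, hx]
  have hrun' : M.run (fin (R.q e) (R.n e)) v₀ = fin y n₀ := by
    rw [M.run_fin (by omega) hn₀, hy]
  have hword : M.outs (fin (R.p e) (R.m e)) (v₀ ++ (wpow z (t + k') ++ v₁ ++ δ.v₂)) ≠
      M.outs (fin (R.q e) (R.n e)) (v₀ ++ (wpow z (t + k') ++ v₁ ++ δ.v₂)) := by
    have hl : (v₀ ++ (wpow z (t + k') ++ v₁ ++ δ.v₂)).length = δ.len := by
      rw [← htot]
      simp [add_assoc]
    have w1 : M.outs (fin (R.p e) (R.m e)) (v₀ ++ (wpow z (t + k') ++ v₁ ++ δ.v₂)) ≠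
        M.outs (inf (R.p e)) (v₀ ++ (wpow z (t + k') ++ v₁ ++ δ.v₂)) := by
      apply M.outs_append_ne
      rw [hrun, run_inf, hx]
      exact outs_ne_of_level hzx hr hβ hz hv₁ (by zify at *; omega) (by rw [hm₀]; exact hlev)
        δ.outs_ne
    rw [M.outs_eq_of_lt (x := inf (R.p e)) (y := inf (R.q e))
      (by rw [hinf]; exact ENat.natCast_lt_top _)] at w1
    rwa [M.outs_eq_of_lt (x := fin (R.q e) (R.n e)) (y := inf (R.q e))
      (by rwa [hl, ← δ.el_eq_len])]
  have hv₂' : δ.v₂ ≠ [] := by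
    intro hv
    have := δ.outs_ne
    rw [hv] at this
    exact this rfl
  obtain ⟨hw, hel⟩ := M.el_run_of_append hword
    (by
      rw [R.el_eq e hlt, ← hlen, ← htot]
      simp [add_assoc])
    (by simp [hv₂'])
  rw [hrun, hrun'] at hw hel
  have hinf' : M.el (inf δ.x) (inf y) = ⊤ := by
    have := M.el_run_eq_top hinf v₀
    rwa [run_inf, run_inf, hx, hy] at this
  have hbelt : |(a : ℤ) * m₁ - b * n₁| ≤ 46 * Fintype.card Q ^ 6 := by
    have h8 := abs_le.mp (h.belt e h.le le_rfl)
    have e6 : (a : ℤ) * m₁ - b * n₁ = (a * R.m e - b * R.n e) +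
        (a * M.eff (R.p e) v₀ - b * M.eff (R.q e) v₀) := by
      rw [hm₁, hn₁, em, en]
      linear_combination -eΔ
    have hab : ∀ (c : ℕ) (E : ℤ), c ≤ Fintype.card Q ^ 2 → -(v₀.length : ℤ) ≤ E → E ≤ v₀.length →
        |(c : ℤ) * E| ≤ 2 * (Fintype.card Q : ℤ) ^ 4 := by
      intro c E hc h9 h10
      rw [abs_mul, abs_of_nonneg (by positivity)]
      calc (c : ℤ) * |E| ≤ (Fintype.card Q : ℤ) ^ 2 * (2 * (Fintype.card Q : ℤ) ^ 2) := by
            refine mul_le_mul (by exact_mod_cast hc) (abs_le.mpr ?_) (abs_nonneg _) (by positivity)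
            zify at hv₀
            constructor <;> linarith
        _ = 2 * (Fintype.card Q : ℤ) ^ 4 := by ring
    have h11 := abs_le.mp (hab a _ h.a_le e0.1 e0.2)
    have h12 := abs_le.mp (hab b _ h.b_le e0'.1 e0'.2)
    zify at p46
    rw [e6, abs_le]
    constructor <;> linarith
  have key := el_le_of_pump (m := m₁) (n := n₁) (k := k') (m₀ := m₀) (n₀ := n₀) (s := t) (a := a)
    (b := b) hzx hzy hr hβ hβ₁ hγ hz hv₁ hv₂
    (by
      rw [hm₁, em, ht', ← hlev]
      push_cast
      ring) δ.outs_ne hinf' h.one_le_a h.a_le h.one_le_b h.b_le hbelt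
    (by zify at *; omega) (by zify at *; omega)
    (by
      zify
      rw [hm₀, hm₁, em, ht']
      ring)
    (by zify at *; omega)
    (by
      rw [← ht', eΔ, hn₀, hn₁, en]
      ring)
    (by
      intro hγ₀
      rw [hn₀, hn₁, en]
      convert hdvd hγ₀ using 1
      ring)
    hw
    (by
      rw [hel]
      simp [add_assoc])
  have f1 := M.el_le_run (fin (R.p i) (R.m i)) (fin (R.q i) (R.n i)) (seg R.g j (e - j))
  have f2 := M.el_le_run (fin (R.p e) m') (fin (R.q e) n') v₀
  rw [r1, r2, R.el_eq i (by omega), length_seg] at f1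
  rw [M.run_fin (m' := m₁) (by zify at *; omega) hm₁, M.run_fin (m' := n₁) (by zify at *; omega) hn₁,
    hx, hy] at f2
  have f3 := f1.trans (add_le_add_right (f2.trans (add_le_add_right key _)) _)
  have f4 : L - i ≤ e - j + (v₀.length + (k' * z.length + v₁.length + δ.v₂.length)) := by
    exact_mod_cast f3
  have f5 : k' * z.length ≤ (t + k') * z.length := Nat.mul_le_mul_right _ (by omega)
  omega

lemma Stretch.end_le_of_lt (h : R.Stretch s e a b)
    (hinf : M.el (inf (R.p e)) (inf (R.q e)) = ⊤)
    (hI : M.el (fin (R.p e) (R.m e)) (inf (R.p e)) < M.el (fin (R.q e) (R.n e)) (inf (R.q e))) :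
    R.m e ≤ 508 * Fintype.card Q ^ 13 ∧ R.n e ≤ 508 * Fintype.card Q ^ 13 := by
  have hK := card_pos_of_state (R.p s)
  have p1 : Fintype.card Q ^ 12 ≤ Fintype.card Q ^ 13 := Nat.pow_le_pow_right hK (by norm_num)
  have p2 : Fintype.card Q ^ 4 ≤ Fintype.card Q ^ 13 := Nat.pow_le_pow_right hK (by norm_num)
  have h1 := h.m_end_lt_of_lt hinf hI
  have h2 := h.n_le e h.le le_rfl
  have h3 : Fintype.card Q * R.m e ≤ Fintype.card Q * (485 * Fintype.card Q ^ 12) :=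
    Nat.mul_le_mul_left _ (by omega)
  have h4 : Fintype.card Q * (485 * Fintype.card Q ^ 12) = 485 * Fintype.card Q ^ 13 := by ring
  omega

lemma Stretch.end_le_of_m_le (h : R.Stretch s e a b) (hm : R.m e ≤ 200 * Fintype.card Q ^ 8) :
    R.m e ≤ 508 * Fintype.card Q ^ 13 ∧ R.n e ≤ 508 * Fintype.card Q ^ 13 := by
  have hK := card_pos_of_state (R.p s)
  have p1 : Fintype.card Q ^ 8 ≤ Fintype.card Q ^ 13 := Nat.pow_le_pow_right hK (by norm_num)
  have p2 : Fintype.card Q ^ 4 ≤ Fintype.card Q ^ 13 := Nat.pow_le_pow_right hK (by norm_num)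
  have p3 : Fintype.card Q ^ 9 ≤ Fintype.card Q ^ 13 := Nat.pow_le_pow_right hK (by norm_num)
  have h2 := h.n_le e h.le le_rfl
  have h3 : Fintype.card Q * R.m e ≤ Fintype.card Q * (200 * Fintype.card Q ^ 8) :=
    Nat.mul_le_mul_left _ hm
  have h4 : Fintype.card Q * (200 * Fintype.card Q ^ 8) = 200 * Fintype.card Q ^ 9 := by ring
  omega

/-- A stretch not ending in a good position ends low. -/
lemma Stretch.end_le (h : R.Stretch s e a b) (hg : ¬ R.Good e) :
    R.m e ≤ 508 * Fintype.card Q ^ 13 ∧ R.n e ≤ 508 * Fintype.card Q ^ 13 := by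
  have hK := card_pos_of_state (R.p s)
  have p1 : Fintype.card Q ^ 8 ≤ Fintype.card Q ^ 13 := Nat.pow_le_pow_right hK (by norm_num)
  have p3 : Fintype.card Q ^ 9 ≤ Fintype.card Q ^ 13 := Nat.pow_le_pow_right hK (by norm_num)
  by_cases hm : R.m e ≤ 200 * Fintype.card Q ^ 8
  · exact h.end_le_of_m_le hm
  by_cases hn : R.n e ≤ 200 * Fintype.card Q ^ 8
  · exact (h.symm.end_le_of_m_le hn).symm
  by_cases hinf : M.el (inf (R.p e)) (inf (R.q e)) = ⊤
  · have hinf' : M.el (inf (R.q e)) (inf (R.p e)) = ⊤ := by rwa [M.el_comm]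
    rcases lt_trichotomy (M.el (fin (R.p e) (R.m e)) (inf (R.p e)))
      (M.el (fin (R.q e) (R.n e)) (inf (R.q e))) with hI | hI | hI
    · exact h.end_le_of_lt hinf hI
    · exact absurd ⟨h.lt, by omega, by omega, hinf, hI⟩ hg
    · exact (h.symm.end_le_of_lt hinf' hI).symm
  · have hinf' : M.el (inf (R.q e)) (inf (R.p e)) ≠ ⊤ := by rwa [M.el_comm]
    have h1 := h.m_end_lt_of_inf hinf
    have h2 : R.n e < _ := h.symm.m_end_lt_of_inf hinf'
    omega

/-- Positions with small counters. -/
def Low (R : M.MinRun L) (i : ℕ) : Prop :=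
  R.m i ≤ 300 * Fintype.card Q ^ 9 ∧ R.n i ≤ 300 * Fintype.card Q ^ 9

lemma el_fin_inf_le_mul {p : Q} {m : ℕ} (hm : 10 * Fintype.card Q ^ 2 ≤ m)
    (h : M.el (fin p m) (inf p) ≠ ⊤) :
    M.el (fin p m) (inf p) ≤ (Fintype.card Q * m + 20 * Fintype.card Q ^ 4 : ℕ) := by
  obtain ⟨δ⟩ := exists_descent hm h
  rw [δ.el_eq_len]
  exact_mod_cast δ.len_le

lemma bnd_le {K : ℕ} (hK : 0 < K) : bnd K (200 * K ^ 8) ≤ 203 * K ^ 9 := by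
  have p1 : K ^ 2 ≤ K ^ 9 := Nat.pow_le_pow_right hK (by norm_num)
  have p2 : K ^ 4 ≤ K ^ 9 := Nat.pow_le_pow_right hK (by norm_num)
  have p3 : K ^ 3 ≤ K ^ 9 := Nat.pow_le_pow_right hK (by norm_num)
  have : bnd K (200 * K ^ 8) = K ^ 2 + K ^ 4 + K ^ 3 + 200 * K ^ 9 := by
    unfold bnd
    ring
  omega

/-- A pair consisting of a low and a high configuration is close to being distinguished. -/
lemma sub_le_of_m_le {i : ℕ} (hi : i < L) (hm : R.m i ≤ 200 * Fintype.card Q ^ 8)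
    (hn : 300 * Fintype.card Q ^ 9 < R.n i) :
    L - i ≤ 203 * Fintype.card Q ^ 9 + Fintype.card Q * R.n i + 20 * Fintype.card Q ^ 4 := by
  have hK := card_pos_of_state (R.p i)
  have p1 : Fintype.card Q ^ 2 ≤ Fintype.card Q ^ 8 := Nat.pow_le_pow_right hK (by norm_num)
  have p2 : Fintype.card Q ^ 2 ≤ Fintype.card Q ^ 9 := Nat.pow_le_pow_right hK (by norm_num)
  have hb := bnd_le hK
  have hel := R.el_eq i hi
  by_cases hc : M.el (fin (R.p i) (R.m i)) (inf (R.q i)) = ⊤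
  · rw [M.el_comm, M.el_congr_right hc] at hel
    have := el_fin_inf_le_mul (p := R.q i) (m := R.n i) (by omega)
      (by rw [hel]; exact ENat.natCast_ne_top _)
    rw [hel] at this
    have : L - i ≤ Fintype.card Q * R.n i + 20 * Fintype.card Q ^ 4 := by exact_mod_cast this
    omega
  · have h1 := M.el_fin_inf_le hm (by omega) hc
    have h2 : M.el (fin (R.p i) (R.m i)) (inf (R.q i)) < M.el (inf (R.q i)) (fin (R.q i) (R.n i)) := by
      rw [M.el_comm (inf _)]
      refine lt_of_le_of_lt (h1.trans ?_) (M.lt_el_inf _ _)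
      exact_mod_cast (by omega)
    rw [M.el_eq_of_lt h2] at hel
    rw [hel] at h1
    have : L - i ≤ bnd (Fintype.card Q) (200 * Fintype.card Q ^ 8) := by exact_mod_cast h1
    omega

lemma sub_le_of_lt {i : ℕ} (hi : i < L) (hm : 200 * Fintype.card Q ^ 8 < R.m i)
    (hinf : M.el (inf (R.p i)) (inf (R.q i)) = ⊤)
    (hI : M.el (fin (R.p i) (R.m i)) (inf (R.p i)) < M.el (fin (R.q i) (R.n i)) (inf (R.q i))) :
    L - i ≤ Fintype.card Q * R.m i + 20 * Fintype.card Q ^ 4 := by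
  have hK := card_pos_of_state (R.p i)
  have p1 : Fintype.card Q ^ 2 ≤ Fintype.card Q ^ 8 := Nat.pow_le_pow_right hK (by norm_num)
  have h1 := el_fin_inf_le_mul (p := R.p i) (m := R.m i) (by omega) hI.ne_top
  rw [← M.el_fin_fin_of_lt hinf hI, R.el_eq i hi] at h1
  exact_mod_cast h1

/-- Positions that are neither low nor good are close to the end. -/
lemma sub_le {i : ℕ} (hi : i < L) (hl : ¬ R.Low i) (hg : ¬ R.Good i) :
    L - i ≤ 203 * Fintype.card Q ^ 9 + Fintype.card Q * (R.m i + R.n i) +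
      20 * Fintype.card Q ^ 4 := by
  have hK := card_pos_of_state (R.p i)
  have p1 : Fintype.card Q ^ 8 ≤ Fintype.card Q ^ 9 := Nat.pow_le_pow_right hK (by norm_num)
  have p2 : Fintype.card Q ^ 2 ≤ Fintype.card Q ^ 8 := Nat.pow_le_pow_right hK (by norm_num)
  rw [mul_add]
  unfold Low at hl
  by_cases hm : R.m i ≤ 200 * Fintype.card Q ^ 8
  · have := sub_le_of_m_le hi hm (by omega)
    omega
  by_cases hn : R.n i ≤ 200 * Fintype.card Q ^ 8
  · have : L - i ≤ _ + Fintype.card Q * R.m i + _ :=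
      sub_le_of_m_le (R := R.symm) hi hn (show _ < R.m i by omega)
    omega
  by_cases hinf : M.el (inf (R.p i)) (inf (R.q i)) = ⊤
  · have hinf' : M.el (inf (R.q i)) (inf (R.p i)) = ⊤ := by rwa [M.el_comm]
    rcases lt_trichotomy (M.el (fin (R.p i) (R.m i)) (inf (R.p i)))
      (M.el (fin (R.q i) (R.n i)) (inf (R.q i))) with hI | hI | hI
    · have := sub_le_of_lt hi (by omega) hinf hI
      omega
    · exact absurd ⟨hi, by omega, by omega, hinf, hI⟩ hg
    · have : L - i ≤ Fintype.card Q * R.n i + _ :=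
        sub_le_of_lt (R := R.symm) hi (show _ < R.n i by omega) hinf' hI
      omega
  · have h1 := M.el_inf_inf_le hinf
    rw [← M.el_fin_fin_eq_inf (m := R.m i) (n := R.n i) (by omega) (by omega) hinf,
      R.el_eq i hi] at h1
    have : L - i ≤ Fintype.card Q ^ 2 := by exact_mod_cast h1
    omega

/-- A good position preceded only by low and good ones belongs to a stretch; its end is not
good. -/
lemma exists_stretch_of_good {j : ℕ} (h0 : R.Low 0) (hlg : ∀ i, i < j → R.Low i ∨ R.Good i)
    (hj : R.Good j) (hjl : ¬ R.Low j) :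
    ∃ s e a b, R.Stretch s e a b ∧ s < j ∧ j < e ∧ ¬ R.Good e ∧ ∀ k, j ≤ k → k < e → R.Good k := by
  classical
  have hs := Nat.findGreatest_spec (P := R.Low) (m := 0) (n := j) (Nat.zero_le _) h0
  have hs' := Nat.findGreatest_le (P := R.Low) j
  have hmax : ∀ k, Nat.findGreatest R.Low j < k → k ≤ j → ¬ R.Low k := fun k hk hk' =>
    Nat.findGreatest_is_greatest hk hk'
  generalize Nat.findGreatest R.Low j = s at *
  have hsj : s < j := lt_of_le_of_ne hs' fun h => hjl (h ▸ hs)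
  have hex : ∃ e, j < e ∧ ¬ R.Good e := ⟨L + j + 1, by omega, fun h => by have := h.lt; omega⟩
  obtain ⟨h1, h2⟩ := Nat.find_spec hex
  have h3 : ∀ k, k < Nat.find hex → ¬(j < k ∧ ¬ R.Good k) := fun k hk => Nat.find_min hex hk
  generalize Nat.find hex = e at *
  have hgood : ∀ k, j ≤ k → k < e → R.Good k := by
    intro k hk hk'
    rcases hk.eq_or_lt with rfl | hk
    · exact hj
    · by_contra hc
      exact h3 k hk' ⟨hk, hc⟩
  obtain ⟨a, b, hst⟩ := exists_stretch (R := R) (s := s) (e := e) (by omega)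
    (fun k hk hk' => by
      rcases Nat.lt_or_ge k j with hkj | hkj
      · exact (hlg k hkj).resolve_left (hmax k hk hkj.le)
      · exact hgood k hkj hk') hs.1 hs.2
  exact ⟨s, e, a, b, hst, hsj, h1, h2, hgood⟩

lemma m_lt_of_good (h0 : R.Low 0) {j : ℕ} (hlg : ∀ i, i < j → R.Low i ∨ R.Good i)
    (hj : R.Good j) : R.m j < 8033 * Fintype.card Q ^ 16 := by
  have hK := card_pos_of_state (R.p 0)
  have p0 : 0 < Fintype.card Q ^ 16 := Nat.pow_pos hK
  have p1 : Fintype.card Q ^ 9 ≤ Fintype.card Q ^ 13 := Nat.pow_le_pow_right hK (by norm_num)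
  have p2 : Fintype.card Q ^ 13 ≤ Fintype.card Q ^ 16 := Nat.pow_le_pow_right hK (by norm_num)
  by_cases hl : R.Low j
  · have := hl.1
    omega
  · obtain ⟨s, e, a, b, hS, hsj, hje, hge, -⟩ := exists_stretch_of_good h0 hlg hj hl
    have := hS.m_lt (l := 508 * Fintype.card Q ^ 13) (j := j) (by omega) (hS.end_le hge).1
      (by omega) (by omega)
    omega

lemma card_low_le (s : Finset ℕ) (hs : ∀ i ∈ s, i < L) (hlow : ∀ i ∈ s, R.Low i) :
    s.card ≤ 90601 * Fintype.card Q ^ 20 := by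
  classical
  have hK := card_pos_of_state (R.p 0)
  have p1 : 0 < Fintype.card Q ^ 9 := Nat.pow_pos hK
  have := M.card_le_of_determined R.el_eq s hs (fun i => (R.p i, R.q i, R.m i, R.n i))
    (Finset.univ ×ˢ Finset.univ ×ˢ Finset.range (301 * Fintype.card Q ^ 9) ×ˢ
      Finset.range (301 * Fintype.card Q ^ 9)) (by
        intro i hi
        have h1 := (hlow i hi).1
        have h2 := (hlow i hi).2
        simp only [Finset.mem_product, Finset.mem_univ, Finset.mem_range, true_and]
        omega) (by
        intro i _ j _ hij
        simp only [Prod.mk.injEq] at hij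
        rw [hij.1, hij.2.1, hij.2.2.1, hij.2.2.2])
  simp only [Finset.card_product, Finset.card_univ, Finset.card_range] at this
  calc _ ≤ _ := this
    _ = _ := by ring

lemma card_good_le (s : Finset ℕ) (hgood : ∀ i ∈ s, R.Good i)
    (hm : ∀ i ∈ s, R.m i < 8033 * Fintype.card Q ^ 16) :
    s.card ≤ 329353 * Fintype.card Q ^ 25 := by
  classical
  have hK := card_pos_of_state (R.p 0)
  have hδ : ∀ i, ∃ c : ℕ × ℕ, i ∈ s → 1 ≤ c.1 ∧ c.1 ≤ Fintype.card Q ∧ 1 ≤ c.2 ∧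
      c.2 ≤ Fintype.card Q ∧ ∃ I : ℕ, M.el (fin (R.p i) (R.m i)) (inf (R.p i)) = I ∧
      |(c.2 : ℤ) * I - c.1 * R.n i| ≤ c.2 * (20 * (Fintype.card Q : ℤ) ^ 4) := by
    intro i
    by_cases hi : i ∈ s
    · obtain ⟨δ⟩ := (hgood i hi).symm.nonempty_descent
      have h1 := δ.one_le_β
      have h2 := δ.β_le_length
      have h3 := δ.length_z
      refine ⟨(δ.z.length, δ.β), fun _ => ⟨by omega, h3, h1, by omega, δ.len, ?_, δ.belt⟩⟩
      rw [(hgood i hi).el_eq_el]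
      exact δ.el_eq_len
    · exact ⟨(0, 0), fun h => absurd h hi⟩
  choose c hc using hδ
  have hoff : ∀ i, ∃ o : ℤ, i ∈ s → o ∈ Finset.Ico (-(20 * (Fintype.card Q : ℤ) ^ 5))
      (21 * (Fintype.card Q : ℤ) ^ 5) ∧ ∃ I : ℕ,
      M.el (fin (R.p i) (R.m i)) (inf (R.p i)) = I ∧ o = ((c i).2 : ℤ) * I - (c i).1 * R.n i := by
    intro i
    by_cases hi : i ∈ s
    · obtain ⟨-, -, -, h4, I, hI, hb⟩ := hc i hi
      refine ⟨_, fun _ => ⟨?_, I, hI, rfl⟩⟩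
      have hK' : (0 : ℤ) < (Fintype.card Q : ℤ) ^ 5 := by positivity
      have h5 : ((c i).2 : ℤ) * (20 * (Fintype.card Q : ℤ) ^ 4) ≤
          Fintype.card Q * (20 * (Fintype.card Q : ℤ) ^ 4) := by
        gcongr
      have h6 : (Fintype.card Q : ℤ) * (20 * (Fintype.card Q : ℤ) ^ 4) =
        20 * (Fintype.card Q : ℤ) ^ 5 := by ring
      rw [abs_le] at hb
      rw [Finset.mem_Ico]
      constructor <;> linarith [hb.1, hb.2]
    · exact ⟨0, fun h => absurd h hi⟩
  choose o ho using hoff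
  have := M.card_le_of_determined R.el_eq s (fun i hi => (hgood i hi).lt)
    (fun i => (R.p i, R.q i, R.m i, (c i).1, (c i).2, o i))
    (Finset.univ ×ˢ Finset.univ ×ˢ Finset.range (8033 * Fintype.card Q ^ 16) ×ˢ
      Finset.Icc 1 (Fintype.card Q) ×ˢ Finset.Icc 1 (Fintype.card Q) ×ˢ
      Finset.Ico (-(20 * (Fintype.card Q : ℤ) ^ 5)) (21 * (Fintype.card Q : ℤ) ^ 5)) (by
        intro i hi
        obtain ⟨h1, h2, h3, h4, -⟩ := hc i hi
        simp only [Finset.mem_product, Finset.mem_univ, Finset.mem_range, true_and,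
          Finset.mem_Icc]
        exact ⟨hm i hi, ⟨h1, h2⟩, ⟨h3, h4⟩, (ho i hi).1⟩) (by
        intro i hi j hj hij
        simp only [Prod.mk.injEq] at hij
        obtain ⟨e1, e2, e3, e4, e5, e6⟩ := hij
        obtain ⟨-, I, hI, hoI⟩ := ho i hi
        obtain ⟨-, J, hJ, hoJ⟩ := ho j hj
        rw [e1, e3, hJ] at hI
        have hIJ : J = I := by exact_mod_cast hI
        have h1 := (hc j hj).1
        rw [e6, hoJ, e4, e5, hIJ] at hoI
        have h2 : ((c j).1 : ℤ) * R.n i = (c j).1 * R.n j := by linarith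
        have h3 : (R.n i : ℤ) = R.n j := mul_left_cancel₀ (by positivity) h2
        have h4 : R.n i = R.n j := by exact_mod_cast h3
        rw [e1, e2, e3, h4])
  simp only [Finset.card_product, Finset.card_univ, Finset.card_range, Nat.card_Icc,
    Int.card_Ico] at this
  have hoc : (21 * (Fintype.card Q : ℤ) ^ 5 - -(20 * (Fintype.card Q : ℤ) ^ 5)).toNat =
      41 * Fintype.card Q ^ 5 := by
    have : 21 * (Fintype.card Q : ℤ) ^ 5 - -(20 * (Fintype.card Q : ℤ) ^ 5) =
        ((41 * Fintype.card Q ^ 5 : ℕ) : ℤ) := by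
      push_cast
      ring
    rw [this, Int.toNat_natCast]
  rw [hoc, Nat.add_sub_cancel] at this
  calc _ ≤ _ := this
    _ = _ := by ring

lemma sub_le_of_first (h0 : R.Low 0) {t : ℕ} (ht : t < L) (hl : ¬ R.Low t) (hg : ¬ R.Good t)
    (hlg : ∀ i, i < t → R.Low i ∨ R.Good i) : L - t ≤ 2000 * Fintype.card Q ^ 14 := by
  have hK := card_pos_of_state (R.p 0)
  have p0 : 0 < Fintype.card Q ^ 9 := Nat.pow_pos hK
  have p1 : Fintype.card Q ^ 9 ≤ Fintype.card Q ^ 13 := Nat.pow_le_pow_right hK (by norm_num)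
  have p2 : Fintype.card Q ^ 13 ≤ Fintype.card Q ^ 14 := Nat.pow_le_pow_right hK (by norm_num)
  have p3 : Fintype.card Q ^ 4 ≤ Fintype.card Q ^ 9 := Nat.pow_le_pow_right hK (by norm_num)
  have hmn : R.m t ≤ 508 * Fintype.card Q ^ 13 ∧ R.n t ≤ 508 * Fintype.card Q ^ 13 := by
    obtain _ | j := t
    · exact absurd h0 hl
    by_cases hlj : R.Low j
    · have h1 := (R.traj_m.slow j).1
      have h2 := (R.traj_n.slow j).1
      have h3 := hlj.1
      have h4 := hlj.2
      omega
    · obtain ⟨s, e, a, b, hS, hsj, hje, hge, hgood⟩ := exists_stretch_of_good h0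
        (fun i hi => hlg i (by omega)) ((hlg j (by omega)).resolve_left hlj) hlj
      obtain rfl : e = j + 1 := by
        by_contra hne
        exact hg (hgood (j + 1) (by omega) (by omega))
      exact hS.end_le hg
  have h1 := sub_le ht hl hg
  have h2 : Fintype.card Q * (R.m t + R.n t) ≤ Fintype.card Q * (1016 * Fintype.card Q ^ 13) :=
    Nat.mul_le_mul_left _ (by omega)
  have h3 : Fintype.card Q * (1016 * Fintype.card Q ^ 13) = 1016 * Fintype.card Q ^ 14 := by ring
  omega

lemma le_of_forall_low_or_good (h0 : R.Low 0) {t : ℕ} (ht : t ≤ L)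
    (hlg : ∀ i, i < t → R.Low i ∨ R.Good i) : t ≤ 419954 * Fintype.card Q ^ 25 := by
  classical
  have hK := card_pos_of_state (R.p 0)
  have p1 : Fintype.card Q ^ 20 ≤ Fintype.card Q ^ 25 := Nat.pow_le_pow_right hK (by norm_num)
  have h1 := card_low_le (R := R) ((Finset.range t).filter fun i => R.Low i)
    (fun i hi => by
      rw [Finset.mem_filter, Finset.mem_range] at hi
      omega)
    (fun i hi => (Finset.mem_filter.mp hi).2)
  have hgood : ∀ i ∈ (Finset.range t).filter fun i => ¬ R.Low i, i < t ∧ R.Good i := by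
    intro i hi
    rw [Finset.mem_filter, Finset.mem_range] at hi
    exact ⟨hi.1, (hlg i hi.1).resolve_left hi.2⟩
  have h2 := card_good_le (R := R) ((Finset.range t).filter fun i => ¬ R.Low i)
    (fun i hi => (hgood i hi).2)
    (fun i hi => m_lt_of_good h0 (fun k hk => hlg k (hk.trans (hgood i hi).1)) (hgood i hi).2)
  have h3 := Finset.card_filter_add_card_filter_not (s := Finset.range t) (fun i => R.Low i)
  rw [Finset.card_range] at h3
  omega

/-- The length of a minimal run starting with small counters. -/
lemma length_le (h0 : R.Low 0) : L ≤ 10 ^ 6 * Fintype.card Q ^ 26 := by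
  classical
  have hK := card_pos_of_state (R.p 0)
  have p1 : Fintype.card Q ^ 25 ≤ Fintype.card Q ^ 26 := Nat.pow_le_pow_right hK (by norm_num)
  have p2 : Fintype.card Q ^ 14 ≤ Fintype.card Q ^ 26 := Nat.pow_le_pow_right hK (by norm_num)
  by_cases hbad : ∃ t, t < L ∧ ¬ R.Low t ∧ ¬ R.Good t
  · obtain ⟨hlt, hl, hg⟩ := Nat.find_spec hbad
    have hlg : ∀ i, i < Nat.find hbad → R.Low i ∨ R.Good i := by
      intro i hi
      have := Nat.find_min hbad hi
      push Not at this
      by_cases h : R.Low i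
      · exact Or.inl h
      · exact Or.inr (this (hi.trans hlt) h)
    have h1 := le_of_forall_low_or_good h0 hlt.le hlg
    have h2 := sub_le_of_first h0 hlt hl hg hlg
    omega
  · push Not at hbad
    have := le_of_forall_low_or_good h0 le_rfl fun i hi => by
      by_cases h : R.Low i
      · exact Or.inl h
      · exact Or.inr (hbad i hi h)
    omega

end MinRun

/-- Two distinguishable configurations with counter zero are distinguished by a word of
polynomial length. -/
theorem el_zero_zero_le {p q : Q} (h : M.el (fin p 0) (fin q 0) ≠ ⊤) :
    M.el (fin p 0) (fin q 0) ≤ (10 ^ 6 * Fintype.card Q ^ 26 : ℕ) := by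
  obtain ⟨L, hL⟩ := ENat.ne_top_iff_exists.mp h
  obtain ⟨g, X, Y, hX0, hY0, hX, hY, hel⟩ := M.exists_minimal_run hL.symm
  obtain ⟨P, m, hP, hXP⟩ := exists_traj hX hX0
  obtain ⟨R, n, hR, hYR⟩ := exists_traj hY hY0
  let ρ : M.MinRun L := ⟨g, P, R, m, n, hP, hR, fun i hi => by rw [← hXP, ← hYR, hel i hi]⟩
  have hm : m 0 = 0 := by
    have := hX0.symm.trans (hXP 0)
    simpa using (fin.inj this).2.symm
  have hn : n 0 = 0 := by
    have := hY0.symm.trans (hYR 0)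
    simpa using (fin.inj this).2.symm
  have h0 : ρ.Low 0 := ⟨by simp [ρ, hm], by simp [ρ, hn]⟩
  rw [← hL]
  exact_mod_cast MinRun.length_le h0

end Mach

open Mach

/-- The disjoint union of the one-counter machines underlying two automata, the output of a
transition being its weight. -/
def union (A₁ A₂ : DWROCA A S) : Mach (A₁.Q ⊕ A₂.Q) A S where
  nx := Sum.elim (fun q b a => Sum.inl (A₁.next q b a)) (fun q b a => Sum.inr (A₂.next q b a))
  up := Sum.elim A₁.upd A₂.upd
  ou := Sum.elim A₁.wt A₂.wt
  abs_up_le q b a := by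
    rcases q with q | q
    · have := A₁.upd_mem q b a
      simp only [Set.mem_insert_iff, Set.mem_singleton_iff] at this
      rcases this with h | h | h <;> simp [h]
    · have := A₂.upd_mem q b a
      simp only [Set.mem_insert_iff, Set.mem_singleton_iff] at this
      rcases this with h | h | h <;> simp [h]

lemma val_left (A₁ A₂ : DWROCA A S) (q : A₁.Q) (n : ℕ) (s : S) (w : List A) :
    A₁.val (q, n, s) w = s * ((union A₁ A₂).outs (.fin (Sum.inl q) n) w).prod := by
  induction w generalizing q n s with
  | nil => simp [DWROCA.val, DWROCA.run]
  | cons a w ih =>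
    rw [outs_cons, List.prod_cons, ← mul_assoc]
    exact ih _ _ _

lemma val_right (A₁ A₂ : DWROCA A S) (q : A₂.Q) (n : ℕ) (s : S) (w : List A) :
    A₂.val (q, n, s) w = s * ((union A₁ A₂).outs (.fin (Sum.inr q) n) w).prod := by
  induction w generalizing q n s with
  | nil => simp [DWROCA.val, DWROCA.run]
  | cons a w ih =>
    rw [outs_cons, List.prod_cons, ← mul_assoc]
    exact ih _ _ _

lemma out_union_ne_zero (A₁ A₂ : DWROCA A S) (x : Conf (A₁.Q ⊕ A₂.Q)) (a : A) :
    (union A₁ A₂).out x a ≠ 0 := by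
  rcases x with ⟨q | q, n⟩ | q | q
  · exact A₁.wt_ne _ _ _
  · exact A₂.wt_ne _ _ _
  · exact A₁.wt_ne _ _ _
  · exact A₂.wt_ne _ _ _

lemma prod_outs_union_ne_zero (A₁ A₂ : DWROCA A S) (x : Conf (A₁.Q ⊕ A₂.Q)) (w : List A) :
    ((union A₁ A₂).outs x w).prod ≠ 0 := by
  induction w generalizing x with
  | nil => simp
  | cons a w ih =>
    rw [outs_cons, List.prod_cons]
    exact mul_ne_zero (out_union_ne_zero A₁ A₂ x a) (ih _)

/-- On a shortest word with different outputs, the products of the outputs differ. -/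
lemma prod_outs_union_ne (A₁ A₂ : DWROCA A S) {x y : Conf (A₁.Q ⊕ A₂.Q)} {w : List A}
    (hw : (union A₁ A₂).outs x w ≠ (union A₁ A₂).outs y w)
    (hl : (union A₁ A₂).el x y = w.length) :
    ((union A₁ A₂).outs x w).prod ≠ ((union A₁ A₂).outs y w).prod := by
  rcases List.eq_nil_or_concat w with rfl | ⟨v, a, hva⟩
  · exact absurd rfl hw
  obtain rfl : w = v ++ [a] := by simpa using hva
  have hv : (union A₁ A₂).outs x v = (union A₁ A₂).outs y v := by
    by_contra hv
    have h1 := (union A₁ A₂).el_le hv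
    rw [hl] at h1
    have h2 : (v ++ [a]).length ≤ v.length := by exact_mod_cast h1
    simp at h2
  rw [outs_append, outs_append, hv] at hw ⊢
  rw [List.prod_append, List.prod_append]
  intro h
  exact hw (by simpa using mul_left_cancel₀ (prod_outs_union_ne_zero A₁ A₂ y v) h)

/-- Inequivalent automata are distinguished by a word of polynomial length. -/
theorem exists_short_witness (A₁ A₂ : DWROCA A S) (h : A₁.f ≠ A₂.f) :
    ∃ w : List A, w.length ≤ 10 ^ 6 * (Fintype.card A₁.Q + Fintype.card A₂.Q) ^ 26 ∧
      A₁.f w ≠ A₂.f w := by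
  by_cases hs : A₁.s0 = A₂.s0
  · obtain ⟨u, hu⟩ := Function.ne_iff.mp h
    have f₁ (w : List A) := val_left A₁ A₂ A₁.q0 0 A₁.s0 w
    have f₂ (w : List A) := val_right A₁ A₂ A₂.q0 0 A₂.s0 w
    have hne : (union A₁ A₂).outs (.fin (Sum.inl A₁.q0) 0) u ≠
        (union A₁ A₂).outs (.fin (Sum.inr A₂.q0) 0) u := fun he =>
      hu ((f₁ u).trans (by rw [he, hs]; exact (f₂ u).symm))
    have htop : (union A₁ A₂).el (.fin (Sum.inl A₁.q0) 0) (.fin (Sum.inr A₂.q0) 0) ≠ ⊤ :=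
      ne_top_of_le_ne_top (ENat.natCast_ne_top _) ((union A₁ A₂).el_le hne)
    obtain ⟨w, hw, hl⟩ := (union A₁ A₂).exists_word htop
    have hb := (union A₁ A₂).el_zero_zero_le htop
    rw [hl, Fintype.card_sum] at hb
    refine ⟨w, by exact_mod_cast hb, fun he => prod_outs_union_ne A₁ A₂ hw hl ?_⟩
    have : A₁.s0 * _ = A₂.s0 * _ := (f₁ w).symm.trans (Eq.trans he (f₂ w))
    rw [hs] at this
    exact mul_left_cancel₀ A₂.s0_ne this
  · exact ⟨[], by simp, hs⟩

end OneCounter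

/-- if two dwROCAs are not equivalent, then there is a witness
of length at most `P₀(K)` for a fixed polynomial `P₀` of degree `26`, where
`K` is the sum of the numbers of states. -/
theorem polynomial_length_witness :
    ∃ P₀ : Polynomial ℕ, P₀.natDegree ≤ 26 ∧
      ∀ (A S : Type) [Field S] (A₁ A₂ : DWROCA A S),
        A₁.f ≠ A₂.f →
        ∃ w : List A,
          w.length ≤ P₀.eval (Fintype.card A₁.Q + Fintype.card A₂.Q) ∧
          A₁.f w ≠ A₂.f w := by
  refine ⟨Polynomial.C (10 ^ 6) * Polynomial.X ^ 26, Polynomial.natDegree_C_mul_X_pow_le _ _,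
    fun A S _ A₁ A₂ h => ?_⟩
  obtain ⟨w, hw, hne⟩ := OneCounter.exists_short_witness A₁ A₂ h
  exact ⟨w, by simpa using hw, hne⟩
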